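/- arXiv:2002.04963 — 3 statements merged into one kernel-verified Lean document; each statement's English description precedes it below -/
import Mathlib

section
/- Let d = 1 and p = 2 (note 2 < 1 + 2/1 = 3, so the energy is well defined). Then J(N) = N · J(1) for every N ∈ ℕ, and for every N ≥ 2 no admissible N-tuple attains the infimum J(N). -/
open MeasureTheory Real Filter Topology

noncomputable section

/-- Euclidean space `ℝ^d`. -/
abbrev Ed (d : ℕ) : Type := EuclideanSpace ℝ (Fin d)

/-- An admissible `N`-tuple: each component is continuously differentiable,
square-integrable with square-integrable gradient, and the components are
orthonormal in `L²(ℝ^d)`. -/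
structure Admissible (d N : ℕ) (u : Fin N → Ed d → ℂ) : Prop where
  contDiff : ∀ n, ContDiff ℝ 1 (u n)
  sqInt : ∀ n, Integrable (fun x : Ed d => ‖u n x‖ ^ 2)
  gradSqInt : ∀ n, Integrable (fun x : Ed d => ‖fderiv ℝ (u n) x‖ ^ 2)
  orthonormal : ∀ j k, ∫ x : Ed d, u j x * (starRingEnd ℂ) (u k x)
      = if j = k then 1 else 0

/-- The density `ρ_u = ∑ₙ |uₙ|²` of an `N`-tuple. -/
def density (d N : ℕ) (u : Fin N → Ed d → ℂ) (x : Ed d) : ℝ :=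
  ∑ n, ‖u n x‖ ^ 2

/-- The NLS energy of an `N`-tuple. -/
def energy (d N : ℕ) (p : ℝ) (u : Fin N → Ed d → ℂ) : ℝ :=
  (∑ n, ∫ x : Ed d, ‖fderiv ℝ (u n) x‖ ^ 2)
    - (1 / p) * ∫ x : Ed d, density d N u x ^ p

/-- `J(N)`: the infimum of the energy over admissible `N`-tuples. -/
def J (d : ℕ) (p : ℝ) (N : ℕ) : ℝ :=
  sInf { e : ℝ | ∃ u : Fin N → Ed d → ℂ, Admissible d N u ∧ e = energy d N p u }

/-- The occupation weight: `λ - N + 1` on the last index, `1` otherwise. -/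
def wt (N : ℕ) (lam : ℝ) (n : Fin N) : ℝ :=
  if (n : ℕ) = N - 1 then lam - N + 1 else 1

/-- The weighted density `ρ_{u,λ}`. -/
def densityW (d N : ℕ) (lam : ℝ) (u : Fin N → Ed d → ℂ) (x : Ed d) : ℝ :=
  ∑ n, wt N lam n * ‖u n x‖ ^ 2

/-- The weighted kinetic energy `T_λ(u)`. -/
def kineticW (d N : ℕ) (lam : ℝ) (u : Fin N → Ed d → ℂ) : ℝ :=
  ∑ n, wt N lam n * ∫ x : Ed d, ‖fderiv ℝ (u n) x‖ ^ 2

/-- The weighted energy `E_λ(u)`. -/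
def energyW (d N : ℕ) (p lam : ℝ) (u : Fin N → Ed d → ℂ) : ℝ :=
  kineticW d N lam u - (1 / p) * ∫ x : Ed d, densityW d N lam u x ^ p

/-- `J(λ)` for real `λ`: the infimum of the weighted energy over admissible
`⌈λ⌉`-tuples. -/
def Jw (d : ℕ) (p : ℝ) (lam : ℝ) : ℝ :=
  sInf { e : ℝ | ∃ u : Fin ⌈lam⌉₊ → Ed d → ℂ,
    Admissible d ⌈lam⌉₊ u ∧ e = energyW d ⌈lam⌉₊ p lam u }

/-- The one-function NLS infimum `I(d,p,λ)`. -/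
def Infimum1 (d : ℕ) (p lam : ℝ) : ℝ :=
  sInf { e : ℝ | ∃ u : Ed d → ℂ, ContDiff ℝ 1 u ∧
    Integrable (fun x : Ed d => ‖u x‖ ^ 2) ∧
    Integrable (fun x : Ed d => ‖fderiv ℝ u x‖ ^ 2) ∧
    (∫ x : Ed d, ‖u x‖ ^ 2) = lam ∧
    e = (∫ x : Ed d, ‖fderiv ℝ u x‖ ^ 2)
        - (1 / p) * ∫ x : Ed d, ‖u x‖ ^ (2 * p) }

/-- The Laplacian of `f : ℝ^d → ℂ`, as the sum of the second partial
derivatives in the coordinate directions. -/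
def lap (d : ℕ) (f : Ed d → ℂ) (x : Ed d) : ℂ :=
  ∑ i : Fin d,
    fderiv ℝ (fun y => fderiv ℝ f y (EuclideanSpace.single i (1 : ℝ))) x
      (EuclideanSpace.single i (1 : ℝ))

/-- The `q`-spherical average `[f]_q(x)`, computed with respect to the surface
measure on the unit sphere. -/
def sphAvg (d : ℕ) (q : ℝ) (f : Ed d → ℝ) (x : Ed d) : ℝ :=
  (∫ ω : Metric.sphere (0 : Ed d) 1, |f (‖x‖ • (ω : Ed d))| ^ q
      ∂((volume : Measure (Ed d)).toSphere)) ^ (1 / q)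

/-- The surface measure of the unit sphere `S^{d-1} ⊂ ℝ^d`. -/
def omegaSphere (d : ℕ) : ℝ :=
  (((volume : Measure (Ed d)).toSphere) Set.univ).toReal

/-- The Thomas–Fermi constant. -/
def cTF (d : ℕ) : ℝ :=
  (4 * π ^ 2 * d / (d + 2)) * ((d : ℝ) / omegaSphere d) ^ (2 / (d : ℝ))

section MatrixCalculus

attribute [local instance] Matrix.linftyOpNormedRing Matrix.linftyOpNormedAlgebra

variable {N : ℕ}

open Matrix

/-- The vector `w = v' - ¼ (1 - 2M) v`, whose vanishing characterises optimal tuples. -/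
def defect (M : Matrix (Fin N) (Fin N) ℂ) (v v' : Fin N → ℂ) : Fin N → ℂ :=
  v' - (1 / 4 : ℂ) • ((1 - (2 : ℂ) • M) *ᵥ v)

/-- The primitive `¼ v* (1 - 2M) v - tr (M - 2M² + (4/3)M³) / 16`. -/
def primitive (M : Matrix (Fin N) (Fin N) ℂ) (v : Fin N → ℂ) : ℂ :=
  (1 / 4) * (star v ⬝ᵥ (1 - (2 : ℂ) • M) *ᵥ v)
    - (1 / 16) * (M.trace - 2 * (M * M).trace + (4 / 3) * (M * M * M).trace)

/-- The derivative of `primitive` when `M' = v v*`. -/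
def primitiveDeriv (M : Matrix (Fin N) (Fin N) ℂ) (v v' : Fin N → ℂ) : ℂ :=
  (1 / 4) * (star v' ⬝ᵥ (1 - (2 : ℂ) • M) *ᵥ v + star v ⬝ᵥ (1 - (2 : ℂ) • M) *ᵥ v'
      - 2 * (star v ⬝ᵥ v) ^ 2)
    - (1 / 16) * (star v ⬝ᵥ v - 4 * (star v ⬝ᵥ M *ᵥ v) + 4 * (star v ⬝ᵥ (M * M) *ᵥ v))

lemma defect_dotProduct_self {M : Matrix (Fin N) (Fin N) ℂ} (hM : M.IsHermitian)
    (v v' : Fin N → ℂ) :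
    star v' ⬝ᵥ v' - (1 / 2) * (star v ⬝ᵥ v) ^ 2
      = star (defect M v v') ⬝ᵥ defect M v v' + primitiveDeriv M v v' := by
  have hsym : ∀ x y : Fin N → ℂ, star (M *ᵥ x) ⬝ᵥ y = star x ⬝ᵥ M *ᵥ y := by
    intro x y
    rw [star_mulVec, hM.eq, dotProduct_mulVec]
  simp only [defect, primitiveDeriv, sub_mulVec, one_mulVec, smul_mulVec, star_sub, star_smul,
    sub_dotProduct, dotProduct_sub, smul_dotProduct, dotProduct_smul, hsym, ← mulVec_mulVec,
    smul_eq_mul, smul_sub]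
  have h4 : star (1 / 4 : ℂ) = 1 / 4 := by simp
  have h2 : star (2 : ℂ) = 2 := by simp
  rw [h4, h2]
  ring

lemma hasDerivAt_matrix {M : ℝ → Matrix (Fin N) (Fin N) ℂ} {M' : Matrix (Fin N) (Fin N) ℂ}
    {x : ℝ} :
    HasDerivAt M M' x ↔ ∀ j k, HasDerivAt (fun t => M t j k) (M' j k) x :=
  ⟨fun h j => hasDerivAt_pi.1 (hasDerivAt_pi.1 h j),
    fun h => hasDerivAt_pi.2 fun j => hasDerivAt_pi.2 (h j)⟩

lemma HasDerivAt.matrix_trace {M : ℝ → Matrix (Fin N) (Fin N) ℂ}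
    {M' : Matrix (Fin N) (Fin N) ℂ} {x : ℝ} (h : HasDerivAt M M' x) :
    HasDerivAt (fun t => (M t).trace) M'.trace x :=
  HasDerivAt.fun_sum fun i _ => hasDerivAt_matrix.1 h i i

lemma HasDerivAt.dotProduct {f g : ℝ → Fin N → ℂ} {f' g' : Fin N → ℂ} {x : ℝ}
    (hf : HasDerivAt f f' x) (hg : HasDerivAt g g' x) :
    HasDerivAt (fun t => f t ⬝ᵥ g t) (f' ⬝ᵥ g x + f x ⬝ᵥ g') x := by
  simp only [_root_.dotProduct, ← Finset.sum_add_distrib]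
  exact HasDerivAt.fun_sum fun i _ => (hasDerivAt_pi.1 hf i).mul (hasDerivAt_pi.1 hg i)

lemma HasDerivAt.mulVec {M : ℝ → Matrix (Fin N) (Fin N) ℂ} {M' : Matrix (Fin N) (Fin N) ℂ}
    {f : ℝ → Fin N → ℂ} {f' : Fin N → ℂ} {x : ℝ}
    (hM : HasDerivAt M M' x) (hf : HasDerivAt f f' x) :
    HasDerivAt (fun t => M t *ᵥ f t) (M' *ᵥ f x + M x *ᵥ f') x :=
  hasDerivAt_pi.2 fun i => (hasDerivAt_pi.1 hM i).dotProduct hf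

lemma trace_vecMulVec_star_mul (X : Matrix (Fin N) (Fin N) ℂ) (v : Fin N → ℂ) :
    (vecMulVec v (star v) * X).trace = star v ⬝ᵥ X *ᵥ v := by
  rw [vecMulVec_mul, trace_vecMulVec, dotProduct_comm, dotProduct_mulVec]

lemma hasDerivAt_primitive {M : ℝ → Matrix (Fin N) (Fin N) ℂ} {v : ℝ → Fin N → ℂ}
    {v' : Fin N → ℂ} {x : ℝ} (hM : HasDerivAt M (vecMulVec (v x) (star (v x))) x)
    (hv : HasDerivAt v v' x) :
    HasDerivAt (fun t => primitive (M t) (v t)) (primitiveDeriv (M x) (v x) v') x := by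
  set P := vecMulVec (v x) (star (v x)) with hP
  have hB : HasDerivAt (fun t => 1 - (2 : ℂ) • M t) (-((2 : ℂ) • P)) x :=
    (hM.const_smul (2 : ℂ)).const_sub 1
  have h1 := (hv.star.dotProduct (hB.mulVec hv)).const_mul (1 / 4 : ℂ)
  have h2 := ((hM.matrix_trace.sub ((hM.mul hM).matrix_trace.const_mul (2 : ℂ))).add
    (((hM.mul hM).mul hM).matrix_trace.const_mul (4 / 3 : ℂ))).const_mul (1 / 16 : ℂ)
  refine (h1.sub h2).congr_deriv ?_
  have t1 : P.trace = star (v x) ⬝ᵥ v x := by rw [hP, trace_vecMulVec, dotProduct_comm]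
  have t2 : (P * M x).trace = star (v x) ⬝ᵥ M x *ᵥ v x := trace_vecMulVec_star_mul _ _
  have t3 : (P * M x * M x).trace = star (v x) ⬝ᵥ (M x * M x) *ᵥ v x := by
    rw [mul_assoc]; exact trace_vecMulVec_star_mul _ _
  have t4 : star (v x) ⬝ᵥ P *ᵥ v x = (star (v x) ⬝ᵥ v x) ^ 2 := by
    rw [hP, vecMulVec_mulVec, dotProduct_smul]
    simp [sq]
  have c1 : (M x * P).trace = (P * M x).trace := trace_mul_comm _ _
  have c2 : (M x * P * M x).trace = (P * M x * M x).trace := by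
    rw [mul_assoc, trace_mul_comm]
  have c3 : (M x * M x * P).trace = (P * M x * M x).trace := by
    rw [trace_mul_comm, mul_assoc]
  simp only [primitiveDeriv, Pi.mul_apply, add_mul, trace_add, c1, c2, c3, t1, t2, t3,
    neg_mulVec, smul_mulVec, dotProduct_add, dotProduct_neg, dotProduct_smul, t4, smul_eq_mul]
  ring

end MatrixCalculus

section Line

open Matrix

variable {N : ℕ} {v : ℝ → Fin N → ℂ}

/-- Admissible tuples on the real line, written as curves in `ℂ^N`. -/
structure LineAdmissible (v : ℝ → Fin N → ℂ) : Prop where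
  contDiff : ContDiff ℝ 1 v
  sqInt : ∀ j, Integrable (fun t => ‖v t j‖ ^ 2)
  derivSqInt : ∀ j, Integrable (fun t => ‖deriv v t j‖ ^ 2)
  orthonormal : ∀ j k, ∫ t, v t j * (starRingEnd ℂ) (v t k) = if j = k then 1 else 0

/-- The energy `∑ ∫ |vⱼ'|² - ½ ∫ ρ²` of a tuple on the real line. -/
def lineEnergy (v : ℝ → Fin N → ℂ) : ℝ :=
  (∑ j, ∫ t, ‖deriv v t j‖ ^ 2) - (1 / 2) * ∫ t, (∑ j, ‖v t j‖ ^ 2) ^ 2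

/-- The cumulative Gram matrix `∫_{-∞}^x v v*`. -/
def cumulGram (v : ℝ → Fin N → ℂ) (x : ℝ) : Matrix (Fin N) (Fin N) ℂ :=
  Matrix.of fun j k => ∫ t in Set.Iic x, v t j * (starRingEnd ℂ) (v t k)

lemma dotProduct_star_self_eq_ofReal (z : Fin N → ℂ) :
    star z ⬝ᵥ z = ((∑ j, ‖z j‖ ^ 2 : ℝ) : ℂ) := by
  simp [_root_.dotProduct, Complex.conj_mul']

namespace LineAdmissible

lemma continuous (h : LineAdmissible v) : Continuous v := h.contDiff.continuous

lemma continuous_apply (h : LineAdmissible v) (j : Fin N) : Continuous fun t => v t j :=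
  (_root_.continuous_apply j).comp h.continuous

lemma continuous_deriv (h : LineAdmissible v) : Continuous (deriv v) :=
  h.contDiff.continuous_deriv le_rfl

lemma continuous_deriv_apply (h : LineAdmissible v) (j : Fin N) :
    Continuous fun t => deriv v t j :=
  (_root_.continuous_apply j).comp h.continuous_deriv

lemma hasDerivAt (h : LineAdmissible v) (t : ℝ) : HasDerivAt v (deriv v t) t :=
  (h.contDiff.differentiable one_ne_zero t).hasDerivAt

lemma hasDerivAt_apply (h : LineAdmissible v) (t : ℝ) (j : Fin N) :
    HasDerivAt (fun t => v t j) (deriv v t j) t :=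
  hasDerivAt_pi.1 (h.hasDerivAt t) j

lemma memLp (h : LineAdmissible v) (j : Fin N) : MemLp (fun t => v t j) 2 :=
  (memLp_two_iff_integrable_sq_norm (h.continuous_apply j).aestronglyMeasurable).2 (h.sqInt j)

lemma memLp_deriv (h : LineAdmissible v) (j : Fin N) : MemLp (fun t => deriv v t j) 2 :=
  (memLp_two_iff_integrable_sq_norm (h.continuous_deriv_apply j).aestronglyMeasurable).2
    (h.derivSqInt j)

lemma integrable_mul_conj {f g : ℝ → ℂ} (hf : MemLp f 2) (hg : MemLp g 2) :
    Integrable fun t => f t * (starRingEnd ℂ) (g t) :=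
  hf.integrable_mul hg.star

lemma integrable_gram (h : LineAdmissible v) (j k : Fin N) :
    Integrable fun t => v t j * (starRingEnd ℂ) (v t k) :=
  integrable_mul_conj (h.memLp j) (h.memLp k)

lemma continuous_gram (h : LineAdmissible v) (j k : Fin N) :
    Continuous fun t => v t j * (starRingEnd ℂ) (v t k) :=
  (h.continuous_apply j).mul (Complex.continuous_conj.comp (h.continuous_apply k))

lemma hasDerivAt_cumulGram (h : LineAdmissible v) (x : ℝ) :
    HasDerivAt (cumulGram v) (vecMulVec (v x) (star (v x))) x := by
  refine hasDerivAt_matrix.2 fun j k => ?_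
  have hi := h.integrable_gram j k
  have h1 : HasDerivAt (fun y => ∫ t in (0 : ℝ)..y, v t j * (starRingEnd ℂ) (v t k))
      (v x j * (starRingEnd ℂ) (v x k)) x :=
    intervalIntegral.integral_hasDerivAt_right hi.intervalIntegrable
      ((h.continuous_gram j k).stronglyMeasurableAtFilter _ _) (h.continuous_gram j k).continuousAt
  refine (h1.const_add (∫ t in Set.Iic 0, v t j * (starRingEnd ℂ) (v t k))).congr_of_eventuallyEq
    (Eventually.of_forall fun y => ?_)
  have := intervalIntegral.integral_Iic_sub_Iic (a := 0) (b := y) hi.integrableOn hi.integrableOn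
  simp only [cumulGram, Matrix.of_apply, ← this]
  ring

lemma continuous_cumulGram (h : LineAdmissible v) : Continuous (cumulGram v) :=
  continuous_matrix fun j k => continuous_iff_continuousAt.2 fun x =>
    (hasDerivAt_matrix.1 (h.hasDerivAt_cumulGram x) j k).continuousAt

lemma tendsto_cumulGram_atBot (v : ℝ → Fin N → ℂ) : Tendsto (cumulGram v) atBot (𝓝 0) :=
  tendsto_pi_nhds.2 fun _ => tendsto_pi_nhds.2 fun _ =>
    tendsto_integral_Iic_zero tendsto_id

lemma tendsto_cumulGram_atTop (h : LineAdmissible v) : Tendsto (cumulGram v) atTop (𝓝 1) := by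
  refine tendsto_pi_nhds.2 fun j => tendsto_pi_nhds.2 fun k => ?_
  have := (aecover_Iic (μ := volume) (tendsto_id (α := ℝ) (x := atTop)))
    |>.integral_tendsto_of_countably_generated (h.integrable_gram j k)
  rw [h.orthonormal] at this
  exact this

lemma isHermitian_cumulGram (v : ℝ → Fin N → ℂ) (x : ℝ) : (cumulGram v x).IsHermitian := by
  ext j k
  simp only [conjTranspose_apply, cumulGram, of_apply]
  rw [← starRingEnd_apply, ← integral_conj]
  simp [mul_comm]

lemma norm_cumulGram_le (h : LineAdmissible v) (x : ℝ) (j k : Fin N) :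
    ‖cumulGram v x j k‖ ≤ ∫ t, ‖v t j * (starRingEnd ℂ) (v t k)‖ :=
  (norm_integral_le_integral_norm _).trans
    (setIntegral_le_integral (h.integrable_gram j k).norm
      (Eventually.of_forall fun _ => norm_nonneg _))

lemma tendsto_zero (h : LineAdmissible v) :
    Tendsto v atBot (𝓝 0) ∧ Tendsto v atTop (𝓝 0) := by
  have hd : ∀ j t, HasDerivAt (fun t => v t j * (starRingEnd ℂ) (v t j))
      (deriv v t j * (starRingEnd ℂ) (v t j) + v t j * (starRingEnd ℂ) (deriv v t j)) t :=
    fun j t => (h.hasDerivAt_apply t j).mul (h.hasDerivAt_apply t j).star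
  have hi : ∀ j, Integrable fun t =>
      deriv v t j * (starRingEnd ℂ) (v t j) + v t j * (starRingEnd ℂ) (deriv v t j) := fun j =>
    (integrable_mul_conj (h.memLp_deriv j) (h.memLp j)).add
      (integrable_mul_conj (h.memLp j) (h.memLp_deriv j))
  have key : ∀ (j : Fin N) (l : Filter ℝ),
      Tendsto (fun t => v t j * (starRingEnd ℂ) (v t j)) l (𝓝 0) →
      Tendsto (fun t => v t j) l (𝓝 0) := by
    intro j l hl
    rw [tendsto_zero_iff_norm_tendsto_zero] at hl ⊢
    simpa using hl.sqrt
  exact ⟨tendsto_pi_nhds.2 fun j => key j _ (tendsto_zero_of_hasDerivAt_of_integrableOn_Iic (a := 0)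
      (fun t _ => hd j t) (hi j).integrableOn (h.integrable_gram j j).integrableOn),
    tendsto_pi_nhds.2 fun j => key j _ (tendsto_zero_of_hasDerivAt_of_integrableOn_Ioi (a := 0)
      (fun t _ => hd j t) (hi j).integrableOn (h.integrable_gram j j).integrableOn)⟩

lemma bounded (h : LineAdmissible v) : ∃ C, ∀ t, ‖v t‖ ≤ C := by
  have h0 : Tendsto v (cocompact ℝ) (𝓝 0) := by
    rw [cocompact_eq_atBot_atTop, tendsto_sup]
    exact h.tendsto_zero
  let f : ZeroAtInftyContinuousMap ℝ (Fin N → ℂ) := ⟨⟨v, h.continuous⟩, h0⟩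
  exact ⟨‖f.toBCF‖, fun t => f.toBCF.norm_coe_le_norm t⟩

lemma integrable_density (h : LineAdmissible v) : Integrable fun t => ∑ j, ‖v t j‖ ^ 2 :=
  integrable_finsetSum _ fun j _ => h.sqInt j

lemma integrable_density_sq (h : LineAdmissible v) :
    Integrable fun t => (∑ j, ‖v t j‖ ^ 2) ^ 2 := by
  obtain ⟨C, hC⟩ := h.bounded
  have hcont : Continuous fun t => ∑ j, ‖v t j‖ ^ 2 :=
    continuous_finsetSum _ fun j _ => (h.continuous_apply j).norm.pow 2
  have := h.integrable_density.bdd_mul (c := ∑ _j : Fin N, C ^ 2) hcont.aestronglyMeasurable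
    (Eventually.of_forall fun t => by
      rw [Real.norm_of_nonneg (by positivity)]
      gcongr with j
      exact (norm_le_pi_norm (v t) j).trans (hC t))
  simpa [sq] using this

/-- The defect of an admissible tuple along the line. -/
def lineDefect (v : ℝ → Fin N → ℂ) (t : ℝ) : Fin N → ℂ :=
  defect (cumulGram v t) (v t) (deriv v t)

lemma continuous_lineDefect (h : LineAdmissible v) : Continuous (lineDefect v) :=
  h.continuous_deriv.sub
    (((continuous_const.sub (h.continuous_cumulGram.const_smul (2 : ℂ))).matrix_mulVec
      h.continuous).const_smul (1 / 4 : ℂ))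

lemma memLp_lineDefect (h : LineAdmissible v) (j : Fin N) :
    MemLp (fun t => lineDefect v t j) 2 := by
  have hk : ∀ k, MemLp (fun t => cumulGram v t j k * v t k) 2 := fun k =>
    (h.memLp k).of_le_mul
      (((h.continuous_cumulGram.matrix_elem j k).mul (h.continuous_apply k)).aestronglyMeasurable)
      (Eventually.of_forall fun t => by
        rw [norm_mul]
        exact mul_le_mul_of_nonneg_right (h.norm_cumulGram_le t j k) (norm_nonneg _))
  have := (h.memLp_deriv j).sub (((h.memLp j).sub
    ((memLp_finsetSum Finset.univ fun k _ => hk k).const_mul (2 : ℂ))).const_mul (1 / 4 : ℂ))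
  refine this.ae_eq (Eventually.of_forall fun t => ?_)
  simp [lineDefect, defect, sub_mulVec, smul_mulVec, _root_.dotProduct, Matrix.mulVec]

lemma integrable_lineDefect (h : LineAdmissible v) :
    Integrable fun t => ∑ j, ‖lineDefect v t j‖ ^ 2 :=
  integrable_finsetSum _ fun j _ => (h.memLp_lineDefect j).integrable_norm_pow (by norm_num)

lemma continuous_primitive :
    Continuous fun p : Matrix (Fin N) (Fin N) ℂ × (Fin N → ℂ) => primitive p.1 p.2 := by
  unfold primitive
  fun_prop

lemma primitive_zero : primitive (0 : Matrix (Fin N) (Fin N) ℂ) 0 = 0 := by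
  simp [primitive]

lemma primitive_one :
    primitive (1 : Matrix (Fin N) (Fin N) ℂ) 0 = ((-(N / 48) : ℝ) : ℂ) := by
  simp only [primitive, star_zero, zero_dotProduct, mul_one, Matrix.trace_one, Fintype.card_fin]
  push_cast
  ring

lemma primitiveDeriv_eq (v : ℝ → Fin N → ℂ) (t : ℝ) :
    primitiveDeriv (cumulGram v t) (v t) (deriv v t) =
      (((∑ j, ‖deriv v t j‖ ^ 2) - (1 / 2) * (∑ j, ‖v t j‖ ^ 2) ^ 2
        - ∑ j, ‖lineDefect v t j‖ ^ 2 : ℝ) : ℂ) := by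
  have := defect_dotProduct_self (isHermitian_cumulGram v t) (v t) (deriv v t)
  rw [← sub_eq_iff_eq_add'] at this
  rw [← this]
  simp only [dotProduct_star_self_eq_ofReal, lineDefect]
  push_cast
  ring

/-- The energy is the squared norm of the defect up to the constant `-N/48`. -/
theorem lineEnergy_eq (h : LineAdmissible v) :
    lineEnergy v = (∫ t, ∑ j, ‖lineDefect v t j‖ ^ 2) - N / 48 := by
  have hK : Integrable fun t => ∑ j, ‖deriv v t j‖ ^ 2 :=
    integrable_finsetSum _ fun j _ => h.derivSqInt j
  have hR := h.integrable_density_sq.const_mul (1 / 2)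
  have hD := h.integrable_lineDefect
  have hF := (hK.sub hR).sub hD
  have hlim : ∀ {l : Filter ℝ} {M : Matrix (Fin N) (Fin N) ℂ}, Tendsto (cumulGram v) l (𝓝 M) →
      Tendsto v l (𝓝 0) →
      Tendsto (fun t => primitive (cumulGram v t) (v t)) l (𝓝 (primitive M 0)) := by
    intro l M hM hv
    have := ((continuous_primitive (N := N)).tendsto (M, 0)).comp (hM.prodMk_nhds hv)
    simp only [Function.comp_def] at this
    exact this
  have hbot := hlim (tendsto_cumulGram_atBot v) h.tendsto_zero.1
  have htop := hlim h.tendsto_cumulGram_atTop h.tendsto_zero.2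
  rw [primitive_zero] at hbot
  rw [primitive_one] at htop
  have hftc := integral_of_hasDerivAt_of_tendsto
    (fun t => hasDerivAt_primitive (h.hasDerivAt_cumulGram t) (h.hasDerivAt t))
    (by simp only [primitiveDeriv_eq]; exact hF.ofReal) hbot htop
  simp only [primitiveDeriv_eq] at hftc
  have hsplit : ∫ t, ((∑ j, ‖deriv v t j‖ ^ 2) - (1 / 2) * (∑ j, ‖v t j‖ ^ 2) ^ 2
        - ∑ j, ‖lineDefect v t j‖ ^ 2) = lineEnergy v - ∫ t, ∑ j, ‖lineDefect v t j‖ ^ 2 := by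
    refine (integral_sub (hK.sub hR) hD).trans ?_
    refine congrArg (· - _) ((integral_sub hK hR).trans ?_)
    rw [integral_const_mul, integral_finsetSum _ fun j _ => h.derivSqInt j, lineEnergy]
  rw [integral_complex_ofReal, sub_zero, Complex.ofReal_inj, hsplit] at hftc
  linarith

theorem neg_div_le_lineEnergy (h : LineAdmissible v) : -(N / 48 : ℝ) ≤ lineEnergy v := by
  have : 0 ≤ ∫ t, ∑ j, ‖lineDefect v t j‖ ^ 2 := integral_nonneg fun t => by positivity
  rw [h.lineEnergy_eq]
  linarith

lemma lineDefect_eq_zero (h : LineAdmissible v) (hE : lineEnergy v = -(N / 48 : ℝ)) (t : ℝ) :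
    lineDefect v t = 0 := by
  have h0 : ∫ t, ∑ j, ‖lineDefect v t j‖ ^ 2 = 0 := by
    have := h.lineEnergy_eq
    linarith
  have hcont : Continuous fun t => ∑ j, ‖lineDefect v t j‖ ^ 2 :=
    continuous_finsetSum _ fun j _ =>
      ((_root_.continuous_apply j).comp h.continuous_lineDefect).norm.pow 2
  rw [integral_eq_zero_iff_of_nonneg (fun t => by positivity) h.integrable_lineDefect,
    Continuous.ae_eq_iff_eq _ hcont continuous_zero] at h0
  have h1 := congrFun h0 t
  ext j
  have h2 := (Finset.sum_eq_zero_iff_of_nonneg fun j _ => by positivity).1 h1 j (Finset.mem_univ j)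
  simpa using h2

attribute [local instance] Matrix.linftyOpNormedRing Matrix.linftyOpNormedAlgebra

lemma deriv_eq_of_lineDefect_eq_zero {t : ℝ} (h0 : lineDefect v t = 0) :
    deriv v t = ((1 / 4 : ℂ) • (1 - (2 : ℂ) • cumulGram v t)) *ᵥ v t := by
  rw [smul_mulVec]
  exact sub_eq_zero.1 h0

/-- If the defect vanishes, the cumulative Gram matrix solves a logistic equation. -/
lemma logistic_of_lineDefect_eq_zero (h : LineAdmissible v) (h0 : ∀ t, lineDefect v t = 0)
    (t : ℝ) :
    vecMulVec (v t) (star (v t))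
      = (1 / 2 : ℂ) • (cumulGram v t - cumulGram v t * cumulGram v t) := by
  set D : ℝ → Matrix (Fin N) (Fin N) ℂ := fun t => vecMulVec (v t) (star (v t))
    - (1 / 2 : ℂ) • (cumulGram v t - cumulGram v t * cumulGram v t) with hD
  have hderiv : ∀ t, HasDerivAt D 0 t := by
    intro t
    have hP : HasDerivAt (fun t => vecMulVec (v t) (star (v t)))
        (vecMulVec (deriv v t) (star (v t)) + vecMulVec (v t) (star (deriv v t))) t :=
      hasDerivAt_matrix.2 fun j k => (h.hasDerivAt_apply t j).mul (h.hasDerivAt_apply t k).star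
    have hM := h.hasDerivAt_cumulGram t
    refine (hP.sub ((hM.sub (hM.mul hM)).const_smul (1 / 2 : ℂ))).congr_deriv ?_
    have hA : ((1 / 4 : ℂ) • (1 - (2 : ℂ) • cumulGram v t))ᴴ
        = (1 / 4 : ℂ) • (1 - (2 : ℂ) • cumulGram v t) := by
      simp [conjTranspose_smul, (isHermitian_cumulGram v t).eq]
    rw [deriv_eq_of_lineDefect_eq_zero (h0 t), star_mulVec, hA, ← mul_vecMulVec, ← vecMulVec_mul]
    simp only [smul_mul_assoc, mul_smul_comm, sub_mul, mul_sub, one_mul, mul_one]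
    module
  have hconst : ∀ s, D s = D t := fun s => by
    ext j k
    exact is_const_of_deriv_eq_zero
      (fun x => (hasDerivAt_matrix.1 (hderiv x) j k).differentiableAt)
      (fun x => (hasDerivAt_matrix.1 (hderiv x) j k).deriv) s t
  have hlim : Tendsto D atBot (𝓝 0) := by
    have hc : Continuous fun p : Matrix (Fin N) (Fin N) ℂ × (Fin N → ℂ) =>
        vecMulVec p.2 (star p.2) - (1 / 2 : ℂ) • (p.1 - p.1 * p.1) := by
      fun_prop
    have h1 := (hc.tendsto (0, 0)).comp
      ((tendsto_cumulGram_atBot v).prodMk_nhds h.tendsto_zero.1)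
    simp only [Function.comp_def, star_zero, vecMulVec_zero, mul_zero, sub_zero, smul_zero] at h1
    exact h1
  have h1 : D t = 0 := by
    refine tendsto_nhds_unique ?_ hlim
    rw [funext hconst]
    exact tendsto_const_nhds
  exact sub_eq_zero.1 h1

lemma re_star_dotProduct_cumulGram_nonneg (h : LineAdmissible v) (z : Fin N → ℂ) (t : ℝ) :
    0 ≤ (star z ⬝ᵥ cumulGram v t *ᵥ z).re := by
  have hd : ∀ t, HasDerivAt (fun t => (star z ⬝ᵥ cumulGram v t *ᵥ z).re)
      (‖star (v t) ⬝ᵥ z‖ ^ 2) t := by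
    intro t
    have h1 := (hasDerivAt_const t (star z)).dotProduct
      ((h.hasDerivAt_cumulGram t).mulVec (hasDerivAt_const t z))
    refine (Complex.reCLM.hasFDerivAt.comp_hasDerivAt t h1).congr_deriv ?_
    have h2 : star z ⬝ᵥ v t = (starRingEnd ℂ) (star (v t) ⬝ᵥ z) := by
      rw [starRingEnd_apply, star_dotProduct]
    simp only [mulVec_zero, add_zero, zero_dotProduct, zero_add, vecMulVec_mulVec,
      dotProduct_smul, h2, Complex.reCLM_apply]
    rw [MulOpposite.smul_eq_mul_unop, MulOpposite.unop_op, Complex.conj_mul']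
    norm_cast
  have hmono := monotone_of_hasDerivAt_nonneg hd fun t => by positivity
  have hc : Continuous fun M : Matrix (Fin N) (Fin N) ℂ => (star z ⬝ᵥ M *ᵥ z).re := by
    fun_prop
  have hlim := (hc.tendsto 0).comp (tendsto_cumulGram_atBot v)
  simp only [zero_mulVec, dotProduct_zero, Complex.zero_re] at hlim
  exact hmono.le_of_tendsto hlim t

theorem lineEnergy_ne (h : LineAdmissible v) (hN : 2 ≤ N) : lineEnergy v ≠ -(N / 48 : ℝ) := by
  intro hE
  have h0 := h.lineDefect_eq_zero hE
  have hlog := h.logistic_of_lineDefect_eq_zero h0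
  obtain ⟨x, hx⟩ : ∃ x, ‖cumulGram v x‖ < 1 := by
    have h1 := (tendsto_cumulGram_atBot v).norm
    rw [norm_zero] at h1
    exact (h1.eventually_lt_const one_pos).exists
  have : Nontrivial (Fin N) := Fin.nontrivial_iff_two_le.2 hN
  obtain ⟨z, hz, hPz⟩ := exists_mulVec_eq_zero_iff.2 (det_vecMulVec (v x) (star (v x)))
  have hyx : cumulGram v x *ᵥ z = 0 := by
    rw [hlog, smul_mulVec, smul_eq_zero_iff_right (by norm_num), sub_mulVec, ← mulVec_mulVec,
      sub_eq_zero] at hPz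
    by_contra hne
    have h1 := linfty_opNorm_mulVec (cumulGram v x) (cumulGram v x *ᵥ z)
    rw [← hPz] at h1
    have h2 := norm_pos_iff.2 hne
    nlinarith
  set g : ℝ → ℝ := fun t => ∑ j, ‖(cumulGram v t *ᵥ z) j‖ ^ 2 with hg
  have hgd : ∀ t, HasDerivAt g (g t - (star (cumulGram v t *ᵥ z) ⬝ᵥ
      cumulGram v t *ᵥ (cumulGram v t *ᵥ z)).re) t := by
    intro t
    have hy : HasDerivAt (fun t => cumulGram v t *ᵥ z) ((1 / 2 : ℂ) •
        (cumulGram v t *ᵥ z - cumulGram v t *ᵥ (cumulGram v t *ᵥ z))) t := by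
      refine ((h.hasDerivAt_cumulGram t).mulVec (hasDerivAt_const t z)).congr_deriv ?_
      rw [hlog, smul_mulVec, sub_mulVec, mulVec_zero, add_zero, mulVec_mulVec]
    have h1 := Complex.reCLM.hasFDerivAt.comp_hasDerivAt t (hy.star.dotProduct hy)
    have h2 : (Complex.reCLM ∘ fun t => star (cumulGram v t *ᵥ z) ⬝ᵥ cumulGram v t *ᵥ z) = g := by
      ext t
      simp only [Function.comp_apply, dotProduct_star_self_eq_ofReal, Complex.reCLM_apply,
        Complex.ofReal_re, hg]
    rw [h2] at h1
    refine h1.congr_deriv ?_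
    generalize hyt : cumulGram v t *ᵥ z = y
    have hgt : g t = (star y ⬝ᵥ y).re := by
      rw [← h2, ← hyt]; rfl
    have hsym : star (cumulGram v t *ᵥ y) ⬝ᵥ y = star y ⬝ᵥ cumulGram v t *ᵥ y := by
      rw [star_mulVec, (isHermitian_cumulGram v t).eq, dotProduct_mulVec]
    have h4 : star (1 / 2 : ℂ) = 1 / 2 := by simp
    rw [hgt, ← Complex.sub_re, Complex.reCLM_apply]
    congr 1
    simp only [star_smul, star_sub, smul_dotProduct, sub_dotProduct, dotProduct_smul,
      dotProduct_sub, hsym, smul_eq_mul, h4]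
    ring
  have hanti : Antitone fun t => Real.exp (-t) * g t := by
    refine antitone_of_hasDerivAt_nonpos
      (fun t => ((hasDerivAt_id t).neg.exp.mul (hgd t))) fun t => ?_
    have h1 := h.re_star_dotProduct_cumulGram_nonneg (cumulGram v t *ᵥ z) t
    have h2 := mul_nonneg (Real.exp_pos (-t)).le h1
    simp only [id, Pi.neg_apply, Pi.zero_apply]
    nlinarith
  have hgx : g x = 0 := by simp [hg, hyx]
  have hg0 : ∀ t, x ≤ t → cumulGram v t *ᵥ z = 0 := by
    intro t ht
    have h1 : Real.exp (-t) * g t ≤ Real.exp (-x) * g x := hanti ht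
    rw [hgx, mul_zero] at h1
    have h2 : g t = 0 := le_antisymm
      (nonpos_of_mul_nonpos_right h1 (Real.exp_pos _)) (by positivity)
    ext j
    have h3 := (Finset.sum_eq_zero_iff_of_nonneg fun j _ => by positivity).1 h2 j
      (Finset.mem_univ j)
    simpa using h3
  have hc : Continuous fun M : Matrix (Fin N) (Fin N) ℂ => M *ᵥ z := by fun_prop
  have hlim := (hc.tendsto 1).comp h.tendsto_cumulGram_atTop
  rw [one_mulVec] at hlim
  refine hz (tendsto_nhds_unique hlim ?_)
  exact tendsto_const_nhds.congr' ((eventually_ge_atTop x).mono fun t ht => (hg0 t ht).symm)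

end LineAdmissible

end Line

section Soliton

/-- The optimal profile for a single function, `√2/4 · sech (x/4)`. -/
def soliton (x : ℝ) : ℝ := √(sigmoid (x / 2) * (1 - sigmoid (x / 2)) / 2)

lemma soliton_radicand_pos (x : ℝ) : 0 < sigmoid (x / 2) * (1 - sigmoid (x / 2)) / 2 := by
  have h1 := sigmoid_pos (x / 2)
  have h2 := sub_pos.2 (sigmoid_lt_one (x / 2))
  positivity

lemma soliton_pos (x : ℝ) : 0 < soliton x := Real.sqrt_pos.2 (soliton_radicand_pos x)

lemma soliton_sq (x : ℝ) : soliton x ^ 2 = sigmoid (x / 2) * (1 - sigmoid (x / 2)) / 2 :=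
  Real.sq_sqrt (soliton_radicand_pos x).le

lemma soliton_le_one (x : ℝ) : soliton x ≤ 1 := by
  refine Real.sqrt_le_one.2 ?_
  nlinarith [sigmoid_pos (x / 2), sigmoid_lt_one (x / 2)]

lemma hasDerivAt_sigmoid_half (x : ℝ) :
    HasDerivAt (fun x => sigmoid (x / 2)) (soliton x ^ 2) x := by
  have h1 : HasDerivAt (fun x : ℝ => x / 2) (1 / 2) x := (hasDerivAt_id x).div_const 2
  refine ((hasDerivAt_sigmoid (x / 2)).comp x h1).congr_deriv ?_
  rw [soliton_sq]
  ring

lemma hasDerivAt_soliton (x : ℝ) :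
    HasDerivAt soliton ((1 / 4) * (1 - 2 * sigmoid (x / 2)) * soliton x) x := by
  have hs := hasDerivAt_sigmoid_half x
  refine (((hs.mul (hs.const_sub 1)).div_const 2).sqrt
    (soliton_radicand_pos x).ne').congr_deriv ?_
  change _ / (2 * soliton x) = _
  have := (soliton_pos x).ne'
  field_simp
  ring

lemma contDiff_soliton : ContDiff ℝ 1 soliton := by
  have hs : ContDiff ℝ 1 fun x : ℝ => sigmoid (x / 2) :=
    (contDiff_sigmoid.of_le le_top).comp (contDiff_id.div_const 2)
  exact ((hs.mul (contDiff_const.sub hs)).div_const 2).sqrt fun x => (soliton_radicand_pos x).ne'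

lemma tendsto_sigmoid_half_atTop : Tendsto (fun x : ℝ => sigmoid (x / 2)) atTop (𝓝 1) :=
  tendsto_sigmoid_atTop.comp (tendsto_id.atTop_div_const two_pos)

lemma tendsto_sigmoid_half_atBot : Tendsto (fun x : ℝ => sigmoid (x / 2)) atBot (𝓝 0) :=
  tendsto_sigmoid_atBot.comp (tendsto_id.atBot_div_const two_pos)

lemma integrable_soliton_sq : Integrable fun x => soliton x ^ 2 := by
  have hc : Continuous fun x => soliton x ^ 2 := contDiff_soliton.continuous.pow 2
  refine integrable_of_intervalIntegral_norm_bounded (l := atTop) (a := Neg.neg) (b := id) 1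
    (fun i => hc.integrableOn_Ioc) tendsto_neg_atTop_atBot tendsto_id
    (Eventually.of_forall fun i => ?_)
  simp only [norm_pow, Real.norm_of_nonneg (soliton_pos _).le]
  rw [intervalIntegral.integral_eq_sub_of_hasDerivAt (fun x _ => hasDerivAt_sigmoid_half x)
    (hc.intervalIntegrable _ _)]
  linarith [sigmoid_pos (-i / 2), sigmoid_lt_one (id i / 2)]

lemma integral_soliton_sq : ∫ x, soliton x ^ 2 = 1 := by
  rw [integral_of_hasDerivAt_of_tendsto hasDerivAt_sigmoid_half integrable_soliton_sq
    tendsto_sigmoid_half_atBot tendsto_sigmoid_half_atTop, sub_zero]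

lemma continuous_deriv_soliton : Continuous (deriv soliton) :=
  contDiff_soliton.continuous_deriv le_rfl

lemma abs_deriv_soliton_le (x : ℝ) : |deriv soliton x| ≤ soliton x := by
  rw [(hasDerivAt_soliton x).deriv, abs_mul, abs_of_pos (soliton_pos x)]
  refine mul_le_of_le_one_left (soliton_pos x).le (abs_le.2 ⟨?_, ?_⟩) <;>
  nlinarith [sigmoid_pos (x / 2), sigmoid_lt_one (x / 2)]

lemma integrable_deriv_soliton_sq : Integrable fun x => deriv soliton x ^ 2 :=
  integrable_soliton_sq.mono' (continuous_deriv_soliton.pow 2).aestronglyMeasurable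
    (Eventually.of_forall fun x => by
      rw [norm_pow, Real.norm_eq_abs]
      exact pow_le_pow_left₀ (abs_nonneg _) (abs_deriv_soliton_le x) 2)

lemma integrable_soliton_pow_four : Integrable fun x => soliton x ^ 4 :=
  integrable_soliton_sq.mono' (contDiff_soliton.continuous.pow 4).aestronglyMeasurable
    (Eventually.of_forall fun x => by
      rw [norm_pow, Real.norm_of_nonneg (soliton_pos x).le]
      exact pow_le_pow_of_le_one (soliton_pos x).le (soliton_le_one x) (by norm_num))

lemma soliton_energy :
    (∫ x, deriv soliton x ^ 2) - (1 / 2) * ∫ x, soliton x ^ 4 = -(1 / 48) := by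
  have hi := integrable_deriv_soliton_sq.sub (integrable_soliton_pow_four.const_mul (1 / 2))
  have hd : ∀ x, HasDerivAt (fun x => (sigmoid (x / 2) - 4 * sigmoid (x / 2) ^ 2
      + 8 / 3 * sigmoid (x / 2) ^ 3) / 16)
      (deriv soliton x ^ 2 - 1 / 2 * soliton x ^ 4) x := by
    intro x
    have hs := hasDerivAt_sigmoid_half x
    refine (((hs.sub ((hs.pow 2).const_mul 4)).add
      ((hs.pow 3).const_mul (8 / 3))).div_const 16).congr_deriv ?_
    have h4 : soliton x ^ 4 = (soliton x ^ 2) ^ 2 := by ring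
    rw [(hasDerivAt_soliton x).deriv, h4, mul_pow, soliton_sq]
    ring
  have hlim : ∀ {l : Filter ℝ} {a : ℝ}, Tendsto (fun x : ℝ => sigmoid (x / 2)) l (𝓝 a) →
      Tendsto (fun x => (sigmoid (x / 2) - 4 * sigmoid (x / 2) ^ 2
        + 8 / 3 * sigmoid (x / 2) ^ 3) / 16) l (𝓝 ((a - 4 * a ^ 2 + 8 / 3 * a ^ 3) / 16)) :=
    fun h => ((h.sub ((h.pow 2).const_mul 4)).add ((h.pow 3).const_mul (8 / 3))).div_const 16
  have h1 := integral_of_hasDerivAt_of_tendsto hd hi (hlim tendsto_sigmoid_half_atBot)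
    (hlim tendsto_sigmoid_half_atTop)
  have h2 := integral_sub integrable_deriv_soliton_sq
    (integrable_soliton_pow_four.const_mul (1 / 2))
  rw [integral_const_mul] at h2
  rw [← h2]
  refine h1.trans ?_
  norm_num

/-- A fixed smooth cutoff. -/
def cutoff : ContDiffBump (0 : ℝ) := ⟨1, 2, one_pos, one_lt_two⟩

/-- The soliton cut off at scale `n + 1`. -/
def cutSoliton (n : ℕ) (x : ℝ) : ℝ := cutoff (x / (n + 1)) * soliton x

lemma contDiff_cutoff_scaled (n : ℕ) : ContDiff ℝ 1 fun x : ℝ => cutoff (x / (n + 1)) :=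
  cutoff.contDiff.comp (contDiff_id.div_const _)

lemma contDiff_cutSoliton (n : ℕ) : ContDiff ℝ 1 (cutSoliton n) :=
  (contDiff_cutoff_scaled n).mul contDiff_soliton

lemma cutSoliton_eq_zero {n : ℕ} {x : ℝ} (hx : 2 * (n + 1 : ℝ) ≤ |x|) : cutSoliton n x = 0 := by
  have hn : (0 : ℝ) < n + 1 := by positivity
  rw [cutSoliton, cutoff.zero_of_le_dist, zero_mul]
  rw [Real.dist_0_eq_abs, abs_div, abs_of_pos hn, le_div_iff₀ hn]
  exact hx

lemma deriv_cutSoliton (n : ℕ) (x : ℝ) :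
    deriv (cutSoliton n) x = deriv cutoff (x / (n + 1)) * (1 / (n + 1)) * soliton x
      + cutoff (x / (n + 1)) * deriv soliton x := by
  have h1 : HasDerivAt (fun x : ℝ => x / (n + 1)) (1 / (n + 1)) x := (hasDerivAt_id x).div_const _
  have h2 : HasDerivAt cutoff (deriv cutoff (x / (n + 1))) (x / (n + 1)) :=
    ((cutoff.contDiff (n := 1)).differentiable one_ne_zero _).hasDerivAt
  exact ((h2.comp x h1).mul
    (contDiff_soliton.differentiable one_ne_zero x).hasDerivAt).deriv

lemma tendsto_div_natCast_add_one (x : ℝ) :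
    Tendsto (fun n : ℕ => x / ((n : ℝ) + 1)) atTop (𝓝 0) :=
  tendsto_const_nhds.div_atTop (tendsto_natCast_atTop_atTop.atTop_add tendsto_const_nhds)

lemma tendsto_cutoff_div (x : ℝ) :
    Tendsto (fun n : ℕ => cutoff (x / ((n : ℝ) + 1))) atTop (𝓝 1) := by
  have := (cutoff.continuous.tendsto 0).comp (tendsto_div_natCast_add_one x)
  rwa [cutoff.one_of_mem_closedBall (Metric.mem_closedBall_self zero_le_one)] at this

lemma tendsto_cutSoliton (x : ℝ) :
    Tendsto (fun n => cutSoliton n x) atTop (𝓝 (soliton x)) := by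
  simpa [cutSoliton] using (tendsto_cutoff_div x).mul_const (soliton x)

lemma continuous_deriv_cutoff : Continuous (deriv cutoff) :=
  (cutoff.contDiff (n := 1)).continuous_deriv le_rfl

lemma tendsto_deriv_cutSoliton (x : ℝ) :
    Tendsto (fun n => deriv (cutSoliton n) x) atTop (𝓝 (deriv soliton x)) := by
  simp only [deriv_cutSoliton]
  have h1 := (continuous_deriv_cutoff.tendsto 0).comp (tendsto_div_natCast_add_one x)
  simpa using ((h1.mul (tendsto_div_natCast_add_one 1)).mul_const (soliton x)).add
    ((tendsto_cutoff_div x).mul_const (deriv soliton x))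

lemma abs_cutSoliton_le (n : ℕ) (x : ℝ) : |cutSoliton n x| ≤ soliton x := by
  rw [cutSoliton, abs_mul, abs_of_pos (soliton_pos x), abs_of_nonneg cutoff.nonneg]
  exact mul_le_of_le_one_left (soliton_pos x).le cutoff.le_one

lemma exists_abs_deriv_cutSoliton_le :
    ∃ C, 0 ≤ C ∧ ∀ n x, |deriv (cutSoliton n) x| ≤ C * soliton x := by
  obtain ⟨C, hC⟩ := cutoff.hasCompactSupport.deriv.exists_bound_of_continuous
    continuous_deriv_cutoff
  have hC0 : 0 ≤ C := (norm_nonneg _).trans (hC 0)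
  refine ⟨C + 1, by positivity, fun n x => ?_⟩
  have hs := (soliton_pos x).le
  have hn : |(1 / ((n : ℝ) + 1))| ≤ 1 := by
    rw [abs_of_pos (by positivity), div_le_one (by positivity)]
    simp
  rw [deriv_cutSoliton, add_mul]
  refine (abs_add_le _ _).trans (add_le_add ?_ ?_)
  · rw [abs_mul, abs_mul, abs_of_nonneg hs]
    refine mul_le_mul_of_nonneg_right ?_ hs
    exact (mul_le_of_le_one_right (abs_nonneg _) hn).trans (hC _)
  · rw [abs_mul, abs_of_nonneg cutoff.nonneg]
    exact mul_le_mul cutoff.le_one (abs_deriv_soliton_le x) (abs_nonneg _) zero_le_one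

lemma tendsto_integral_cutSoliton_sq :
    Tendsto (fun n => ∫ x, cutSoliton n x ^ 2) atTop (𝓝 1) := by
  rw [← integral_soliton_sq]
  refine tendsto_integral_of_dominated_convergence (fun x => soliton x ^ 2)
    (fun n => ((contDiff_cutSoliton n).continuous.pow 2).aestronglyMeasurable)
    integrable_soliton_sq (fun n => Eventually.of_forall fun x => ?_)
    (Eventually.of_forall fun x => (tendsto_cutSoliton x).pow 2)
  rw [norm_pow, Real.norm_eq_abs]
  exact pow_le_pow_left₀ (abs_nonneg _) (abs_cutSoliton_le n x) 2

lemma tendsto_integral_cutSoliton_pow_four :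
    Tendsto (fun n => ∫ x, cutSoliton n x ^ 4) atTop (𝓝 (∫ x, soliton x ^ 4)) := by
  refine tendsto_integral_of_dominated_convergence (fun x => soliton x ^ 4)
    (fun n => ((contDiff_cutSoliton n).continuous.pow 4).aestronglyMeasurable)
    integrable_soliton_pow_four (fun n => Eventually.of_forall fun x => ?_)
    (Eventually.of_forall fun x => (tendsto_cutSoliton x).pow 4)
  rw [norm_pow, Real.norm_eq_abs]
  exact pow_le_pow_left₀ (abs_nonneg _) (abs_cutSoliton_le n x) 4

lemma tendsto_integral_deriv_cutSoliton_sq :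
    Tendsto (fun n => ∫ x, deriv (cutSoliton n) x ^ 2) atTop (𝓝 (∫ x, deriv soliton x ^ 2)) := by
  obtain ⟨C, hC0, hC⟩ := exists_abs_deriv_cutSoliton_le
  refine tendsto_integral_of_dominated_convergence (fun x => C ^ 2 * soliton x ^ 2)
    (fun n => (((contDiff_cutSoliton n).continuous_deriv le_rfl).pow 2).aestronglyMeasurable)
    (integrable_soliton_sq.const_mul _) (fun n => Eventually.of_forall fun x => ?_)
    (Eventually.of_forall fun x => (tendsto_deriv_cutSoliton x).pow 2)
  rw [norm_pow, Real.norm_eq_abs, ← mul_pow]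
  exact pow_le_pow_left₀ (abs_nonneg _) (hC n x) 2

/-- Normalised compactly supported profiles with energy close to `-1/48`. -/
lemma exists_profile {ε : ℝ} (hε : 0 < ε) :
    ∃ (φ : ℝ → ℝ) (R : ℝ), ContDiff ℝ 1 φ ∧ 0 < R ∧ (∀ x, R ≤ |x| → φ x = 0) ∧
      ∫ x, φ x ^ 2 = 1 ∧
      (∫ x, deriv φ x ^ 2) - (1 / 2) * ∫ x, φ x ^ 4 < -(1 / 48) + ε := by
  have hlim : Tendsto (fun n => (∫ x, deriv (cutSoliton n) x ^ 2) / (∫ x, cutSoliton n x ^ 2)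
      - (1 / 2) * ((∫ x, cutSoliton n x ^ 4) / (∫ x, cutSoliton n x ^ 2) ^ 2)) atTop
      (𝓝 (-(1 / 48))) := by
    have := (tendsto_integral_deriv_cutSoliton_sq.div tendsto_integral_cutSoliton_sq
      one_ne_zero).sub ((tendsto_integral_cutSoliton_pow_four.div
        (tendsto_integral_cutSoliton_sq.pow 2) (by norm_num)).const_mul (1 / 2))
    rwa [div_one, one_pow, div_one, soliton_energy] at this
  obtain ⟨n, hn, hpos⟩ := ((hlim.eventually_lt_const (lt_add_of_pos_right _ hε)).and
    (tendsto_integral_cutSoliton_sq.eventually_const_lt one_pos)).exists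
  set a := ∫ x, cutSoliton n x ^ 2 with ha
  have hsq : √a ^ 2 = a := Real.sq_sqrt hpos.le
  have hsq4 : √a ^ 4 = a ^ 2 := by rw [show √a ^ 4 = (√a ^ 2) ^ 2 by ring, hsq]
  refine ⟨fun x => cutSoliton n x / √a, 2 * (n + 1 : ℝ), (contDiff_cutSoliton n).div_const _,
    by positivity, fun x hx => by simp only [cutSoliton_eq_zero hx, zero_div], ?_, ?_⟩
  · simp only [div_pow, hsq]
    rw [integral_div, ← ha, div_self hpos.ne']
  · simp only [deriv_div_const, div_pow, hsq, hsq4]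
    rw [integral_div, integral_div]
    exact hn

end Soliton

section Upper

open Matrix

/-- The tuple of translates of `φ` by multiples of `L`. -/
def translates (N : ℕ) (φ : ℝ → ℝ) (L : ℝ) (t : ℝ) (j : Fin N) : ℂ := (φ (t - j * L) : ℂ)

variable {N : ℕ} {φ : ℝ → ℝ} {R : ℝ}

lemma contDiff_translates (L : ℝ) (hφ : ContDiff ℝ 1 φ) : ContDiff ℝ 1 (translates N φ L) :=
  contDiff_pi.2 fun _ => Complex.ofRealCLM.contDiff.comp
    (hφ.comp (contDiff_id.sub contDiff_const))

lemma deriv_translates (L : ℝ) (hφ : ContDiff ℝ 1 φ) (t : ℝ) (j : Fin N) :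
    deriv (translates N φ L) t j = ((deriv φ (t - j * L) : ℝ) : ℂ) := by
  have h1 : ∀ j : Fin N, HasDerivAt (fun t => translates N φ L t j)
      ((deriv φ (t - j * L) : ℝ) : ℂ) t := fun j =>
    ((hφ.differentiable one_ne_zero _).hasDerivAt.comp_sub_const t (j * L)).ofReal_comp
  rw [(hasDerivAt_pi.2 h1).deriv]

lemma translates_mul_eq_zero (hR : ∀ x, R ≤ |x| → φ x = 0) {j k : Fin N} (hjk : j ≠ k)
    (hR0 : 0 < R) (t : ℝ) : φ (t - j * (2 * R)) * φ (t - k * (2 * R)) = 0 := by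
  by_contra hne
  obtain ⟨h1, h2⟩ := mul_ne_zero_iff.1 hne
  have h3 : |t - j * (2 * R)| < R := lt_of_not_ge fun h => h1 (hR _ h)
  have h4 : |t - k * (2 * R)| < R := lt_of_not_ge fun h => h2 (hR _ h)
  rw [abs_lt] at h3 h4
  have hjk' : (j : ℕ) ≠ k := fun h => hjk (Fin.ext h)
  rcases Nat.lt_or_gt_of_ne hjk' with h | h
  · have h5 : ((j : ℕ) : ℝ) + 1 ≤ (k : ℕ) := by exact_mod_cast h
    nlinarith
  · have h5 : ((k : ℕ) : ℝ) + 1 ≤ (j : ℕ) := by exact_mod_cast h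
    nlinarith

lemma hasCompactSupport_of_eq_zero (hR : ∀ x, R ≤ |x| → φ x = 0) : HasCompactSupport φ :=
  HasCompactSupport.of_support_subset_isCompact (isCompact_closedBall (0 : ℝ) R) fun x hx => by
    rw [mem_closedBall_zero_iff, Real.norm_eq_abs]
    exact le_of_not_ge fun h => hx (hR x h)

lemma integrable_pow_of_hasCompactSupport {f : ℝ → ℝ} (hf : Continuous f)
    (hc : HasCompactSupport f) {n : ℕ} (hn : n ≠ 0) : Integrable fun x => f x ^ n :=
  (hf.pow n).integrable_of_hasCompactSupport
    (hc.comp_left (g := fun y => y ^ n) (zero_pow hn))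

lemma lineAdmissible_translates (hφ : ContDiff ℝ 1 φ) (hR0 : 0 < R)
    (hR : ∀ x, R ≤ |x| → φ x = 0) (h1 : ∫ x, φ x ^ 2 = 1) :
    LineAdmissible (translates N φ (2 * R)) where
  contDiff := contDiff_translates _ hφ
  sqInt j := by
    have := (integrable_pow_of_hasCompactSupport hφ.continuous
      (hasCompactSupport_of_eq_zero hR) two_ne_zero).comp_sub_right (j * (2 * R))
    simpa [translates] using this
  derivSqInt j := by
    have := (integrable_pow_of_hasCompactSupport (hφ.continuous_deriv le_rfl)
      (hasCompactSupport_of_eq_zero hR).deriv two_ne_zero).comp_sub_right (j * (2 * R))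
    simpa [deriv_translates _ hφ] using this
  orthonormal j k := by
    simp only [translates, Complex.conj_ofReal, ← Complex.ofReal_mul]
    rw [integral_complex_ofReal]
    split_ifs with hjk
    · subst hjk
      simp only [← sq]
      rw [integral_sub_right_eq_self fun x => φ x ^ 2, h1, Complex.ofReal_one]
    · simp [translates_mul_eq_zero hR hjk hR0]

lemma lineEnergy_translates (hφ : ContDiff ℝ 1 φ) (hR0 : 0 < R)
    (hR : ∀ x, R ≤ |x| → φ x = 0) :
    lineEnergy (translates N φ (2 * R))
      = N * ((∫ x, deriv φ x ^ 2) - (1 / 2) * ∫ x, φ x ^ 4) := by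
  have hdens : ∀ t, (∑ j, ‖translates N φ (2 * R) t j‖ ^ 2) ^ 2
      = ∑ j : Fin N, φ (t - j * (2 * R)) ^ 4 := by
    intro t
    simp only [translates, Complex.norm_real, Real.norm_eq_abs, sq_abs]
    rw [sq, Finset.sum_mul_sum]
    refine Finset.sum_congr rfl fun j _ => ?_
    rw [Finset.sum_eq_single j]
    · ring
    · intro k _ hk
      rw [← mul_pow, translates_mul_eq_zero hR hk.symm hR0, zero_pow two_ne_zero]
    · simp
  have h4 : ∀ j : Fin N, Integrable fun t => φ (t - j * (2 * R)) ^ 4 := fun j =>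
    (integrable_pow_of_hasCompactSupport hφ.continuous
      (hasCompactSupport_of_eq_zero hR) four_ne_zero).comp_sub_right (j * (2 * R))
  simp only [lineEnergy, hdens, deriv_translates _ hφ, Complex.norm_real, Real.norm_eq_abs, sq_abs]
  rw [integral_finsetSum _ fun j _ => h4 j]
  have h4' : ∀ a, ∫ t, φ (t - a) ^ 4 = ∫ t, φ t ^ 4 := integral_sub_right_eq_self fun x => φ x ^ 4
  have h2' : ∀ a, ∫ t, deriv φ (t - a) ^ 2 = ∫ t, deriv φ t ^ 2 :=
    integral_sub_right_eq_self fun x => deriv φ x ^ 2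
  simp only [h4', h2', Finset.sum_const, Finset.card_univ, Fintype.card_fin, nsmul_eq_mul]
  ring

lemma exists_lineEnergy_lt (N : ℕ) {ε : ℝ} (hε : 0 < ε) :
    ∃ v : ℝ → Fin N → ℂ, LineAdmissible v ∧ lineEnergy v < -(N / 48 : ℝ) + ε := by
  obtain ⟨φ, R, hφ, hR0, hR, h1, hE⟩ := exists_profile (ε := ε / (N + 1)) (by positivity)
  refine ⟨_, lineAdmissible_translates hφ hR0 hR h1, ?_⟩
  rw [lineEnergy_translates hφ hR0 hR]
  have h2 : (N : ℝ) * (ε / (N + 1)) < ε := by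
    rw [mul_div_assoc', div_lt_iff₀ (by positivity)]
    nlinarith
  have h3 := mul_le_mul_of_nonneg_left hE.le (Nat.cast_nonneg (α := ℝ) N)
  linarith

end Upper

section Transfer

variable {N : ℕ}

/-- The isometry between the line and one-dimensional Euclidean space. -/
def lineIso : ℝ ≃ₗᵢ[ℝ] Ed 1 := (OrthonormalBasis.singleton (Fin 1) ℝ).repr

/-- An `N`-tuple on `Ed 1` read on the line. -/
def toLine (u : Fin N → Ed 1 → ℂ) (t : ℝ) (j : Fin N) : ℂ := u j (lineIso t)

lemma integrable_comp_lineIso {f : Ed 1 → ℝ} :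
    (Integrable fun t => f (lineIso t)) ↔ Integrable f :=
  lineIso.measurePreserving.integrable_comp_emb lineIso.toHomeomorph.measurableEmbedding

lemma integral_comp_lineIso {E : Type*} [NormedAddCommGroup E] [NormedSpace ℝ E] (f : Ed 1 → E) :
    ∫ t, f (lineIso t) = ∫ x, f x :=
  lineIso.measurePreserving.integral_comp lineIso.toHomeomorph.measurableEmbedding f

lemma contDiff_toLine {u : Fin N → Ed 1 → ℂ} :
    ContDiff ℝ 1 (toLine u) ↔ ∀ j, ContDiff ℝ 1 (u j) := by
  rw [contDiff_pi]
  exact forall_congr' fun j => lineIso.toContinuousLinearEquiv.contDiff_comp_iff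

lemma norm_deriv_toLine {u : Fin N → Ed 1 → ℂ} (hu : ∀ j, ContDiff ℝ 1 (u j)) (t : ℝ)
    (j : Fin N) : ‖deriv (toLine u) t j‖ = ‖fderiv ℝ (u j) (lineIso t)‖ := by
  have hd := ((contDiff_toLine.2 hu).differentiable one_ne_zero t).hasDerivAt
  rw [← (hasDerivAt_pi.1 hd j).deriv, norm_deriv_eq_norm_fderiv]
  have h1 : fderiv ℝ (fun t => toLine u t j) t
      = (fderiv ℝ (u j) (lineIso t)).comp (lineIso.toContinuousLinearEquiv : ℝ →L[ℝ] Ed 1) :=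
    lineIso.toContinuousLinearEquiv.comp_right_fderiv
  rw [h1]
  exact ContinuousLinearMap.opNorm_comp_linearIsometryEquiv _ lineIso

lemma lineAdmissible_toLine {u : Fin N → Ed 1 → ℂ} :
    LineAdmissible (toLine u) ↔ Admissible 1 N u := by
  constructor
  · intro h
    have hu := contDiff_toLine.1 h.contDiff
    exact ⟨hu, fun j => integrable_comp_lineIso.1 (h.sqInt j),
      fun j => integrable_comp_lineIso.1
        (by simpa only [norm_deriv_toLine hu] using h.derivSqInt j),
      fun j k => (integral_comp_lineIso _).symm.trans (h.orthonormal j k)⟩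
  · intro h
    exact ⟨contDiff_toLine.2 h.contDiff, fun j => integrable_comp_lineIso.2 (h.sqInt j),
      fun j => by
        simpa only [norm_deriv_toLine h.contDiff] using
          integrable_comp_lineIso.2 (h.gradSqInt j),
      fun j k => (integral_comp_lineIso fun x => u j x * (starRingEnd ℂ) (u k x)).trans
        (h.orthonormal j k)⟩

lemma lineEnergy_toLine {u : Fin N → Ed 1 → ℂ} (h : Admissible 1 N u) :
    lineEnergy (toLine u) = energy 1 N 2 u := by
  simp only [lineEnergy, energy, norm_deriv_toLine h.contDiff, Real.rpow_two]
  congr 1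
  · exact Finset.sum_congr rfl fun j _ => integral_comp_lineIso fun x => ‖fderiv ℝ (u j) x‖ ^ 2
  · exact congrArg _ (integral_comp_lineIso fun x => density 1 N u x ^ 2)

lemma exists_toLine_eq (v : ℝ → Fin N → ℂ) : ∃ u : Fin N → Ed 1 → ℂ, toLine u = v :=
  ⟨fun j x => v (lineIso.symm x) j, by ext t j; simp [toLine]⟩

theorem J_one_two (N : ℕ) : J 1 2 N = -(N / 48 : ℝ) := by
  refine csInf_eq_of_forall_ge_of_forall_gt_exists_lt ?_ ?_ ?_
  · obtain ⟨v, hv, -⟩ := exists_lineEnergy_lt N one_pos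
    obtain ⟨u, rfl⟩ := exists_toLine_eq v
    exact ⟨_, u, lineAdmissible_toLine.1 hv, rfl⟩
  · rintro _ ⟨u, hu, rfl⟩
    rw [← lineEnergy_toLine hu]
    exact (lineAdmissible_toLine.2 hu).neg_div_le_lineEnergy
  · intro w hw
    obtain ⟨v, hv, hlt⟩ := exists_lineEnergy_lt N (sub_pos.2 hw)
    obtain ⟨u, rfl⟩ := exists_toLine_eq v
    have hu := lineAdmissible_toLine.1 hv
    refine ⟨_, ⟨u, hu, rfl⟩, ?_⟩
    rw [← lineEnergy_toLine hu]
    linarith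

end Transfer

/-- for `d = 1`, `p = 2`, one has `J(N) = N·J(1)` for all `N`, and
for `N ≥ 2` the infimum `J(N)` is not attained. -/
theorem statement2 :
    (∀ N : ℕ, J 1 2 N = N * J 1 2 1) ∧
    (∀ N : ℕ, 2 ≤ N →
      ¬ ∃ u : Fin N → Ed 1 → ℂ, Admissible 1 N u ∧ energy 1 N 2 u = J 1 2 N) := by
  refine ⟨fun N => ?_, ?_⟩
  · rw [J_one_two, J_one_two]
    push_cast
    ring
  · rintro N hN ⟨u, hu, hE⟩
    rw [J_one_two, ← lineEnergy_toLine hu] at hE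
    exact (lineAdmissible_toLine.2 hu).lineEnergy_ne hN hE
end
end

section
/- Let d ≥ 1 and 1 < p < 1 + 2/d. Then for all λ > 0 one has the scaling identity I(d,p,λ) = I(d,p,1) · λ^θ where θ = 1 + (2/d)(p−1)/(1 + 2/d − p) > 1; moreover I(d,p,1) < 0, and consequently the strict binding inequalities I(d,p,λ) < I(d,p,λ−λ') + I(d,p,λ') hold for all 0 < λ' < λ. -/
open MeasureTheory Real Filter Topology

noncomputable section

section EnergyScaling

open scoped ENNReal NNReal

/-- Cauchy–Schwarz bound for the gradient of `w²`. -/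
theorem sq_lintegral_enorm_fderiv_sq_le {E : Type*} [NormedAddCommGroup E] [NormedSpace ℝ E]
    [MeasurableSpace E] [BorelSpace E] (μ : Measure E) {w : E → ℂ}
    (hw : ContDiff ℝ 1 w) :
    (∫⁻ x, ‖fderiv ℝ (fun y => w y ^ 2) x‖ₑ ∂μ) ^ 2
      ≤ 4 * (∫⁻ x, ‖w x‖ₑ ^ 2 ∂μ) * ∫⁻ x, ‖fderiv ℝ w x‖ₑ ^ 2 ∂μ := by
  have hwm : Measurable fun x => ‖w x‖ₑ := hw.continuous.enorm.measurable
  have hdm : Measurable fun x => ‖fderiv ℝ w x‖ₑ :=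
    (hw.continuous_fderiv one_ne_zero).enorm.measurable
  have hpt : ∀ x, ‖fderiv ℝ (fun y => w y ^ 2) x‖ₑ ≤ 2 * (‖w x‖ₑ * ‖fderiv ℝ w x‖ₑ) := by
    intro x
    have hd := (hw.differentiable one_ne_zero x).hasFDerivAt.pow 2
    have : fderiv ℝ (fun y => w y ^ 2) x = (2 * w x) • fderiv ℝ w x := by
      rw [hd.fderiv]; ext v; simp
    rw [this, enorm_smul, enorm_mul, mul_assoc]
    simp [enorm_eq_nnnorm]
  have hCS := ENNReal.lintegral_mul_norm_pow_le (μ := μ) (hwm.pow_const 2).aemeasurable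
    (hdm.pow_const 2).aemeasurable (p := 1 / 2) (q := 1 / 2) (by norm_num) (by norm_num)
    (by norm_num)
  have hsq : ∀ a : ℝ≥0∞, (a ^ 2) ^ (1 / 2 : ℝ) = a := fun a => by
    rw [← ENNReal.rpow_natCast, ← ENNReal.rpow_mul]; norm_num
  have hsq' : ∀ a : ℝ≥0∞, (a ^ (1 / 2 : ℝ)) ^ 2 = a := fun a => by
    rw [← ENNReal.rpow_natCast, ← ENNReal.rpow_mul]; norm_num
  simp only [hsq] at hCS
  calc (∫⁻ x, ‖fderiv ℝ (fun y => w y ^ 2) x‖ₑ ∂μ) ^ 2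
      ≤ (∫⁻ x, 2 * (‖w x‖ₑ * ‖fderiv ℝ w x‖ₑ) ∂μ) ^ 2 := by
        gcongr with x; exact hpt x
    _ = (2 * ∫⁻ x, ‖w x‖ₑ * ‖fderiv ℝ w x‖ₑ ∂μ) ^ 2 := by
        rw [lintegral_const_mul _ (by fun_prop)]
    _ ≤ (2 * ((∫⁻ x, ‖w x‖ₑ ^ 2 ∂μ) ^ (1 / 2 : ℝ)
          * (∫⁻ x, ‖fderiv ℝ w x‖ₑ ^ 2 ∂μ) ^ (1 / 2 : ℝ))) ^ 2 := by
        gcongr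
    _ = _ := by
        rw [mul_pow, mul_pow, hsq', hsq', mul_assoc]; norm_num

/-- In dimension one, a compactly supported `C¹` function is bounded by the total mass of its
derivative. -/
theorem enorm_le_lintegral_enorm_fderiv_one {w : Ed 1 → ℂ} (hw : ContDiff ℝ 1 w)
    (hc : HasCompactSupport w) (x : Ed 1) : ‖w x‖ₑ ≤ ∫⁻ y, ‖fderiv ℝ w y‖ₑ := by
  let e : Ed 1 := EuclideanSpace.single 0 1
  have he : ‖e‖ = 1 := by simp [e]
  have hx : ∀ x : Ed 1, x 0 • e = x := fun x => by
    ext i; fin_cases i; simp [e]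
  let L : ℝ →L[ℝ] Ed 1 := (ContinuousLinearMap.id ℝ ℝ).smulRight e
  have hL : ∀ t, L t = t • e := fun t => by simp [L]
  have hemb : IsClosedEmbedding L := by
    apply LinearMap.isClosedEmbedding_of_injective (f := (L : ℝ →ₗ[ℝ] Ed 1))
    rw [LinearMap.ker_eq_bot]
    intro s t hst
    have := congrArg (fun y : Ed 1 => y 0) (show L s = L t from hst)
    simpa [hL, e] using this
  have hmp : MeasurePreserving (fun y : Ed 1 => y 0) :=
    (volume_preserving_funUnique (Fin 1) ℝ).comp (PiLp.volume_preserving_ofLp (Fin 1))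
  have hdL : ∀ t, ‖deriv (w ∘ L) t‖ₑ ≤ ‖fderiv ℝ w (L t)‖ₑ := fun t => by
    have h1 := ((hw.differentiable one_ne_zero (L t)).hasFDerivAt.comp_hasDerivAt t
      L.hasDerivAt).deriv
    rw [h1, enorm_eq_nnnorm, enorm_eq_nnnorm, ENNReal.coe_le_coe, ← NNReal.coe_le_coe]
    have := (fderiv ℝ w (L t)).le_opNorm (L 1)
    rw [hL 1, one_smul, he, mul_one] at this
    simpa [hL] using this
  have hm : Measurable fun t => ‖fderiv ℝ w (L t)‖ₑ :=
    (((hw.continuous_fderiv one_ne_zero).comp L.continuous).enorm).measurable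
  calc ‖w x‖ₑ = ‖(w ∘ L) (x 0)‖ₑ := by simp [hL, hx]
    _ ≤ ∫⁻ t in Set.Iic (x 0), ‖deriv (w ∘ L) t‖ₑ :=
      HasCompactSupport.enorm_le_lintegral_Ici_deriv (hw.comp L.contDiff)
        (hc.comp_isClosedEmbedding hemb) _
    _ ≤ ∫⁻ t, ‖deriv (w ∘ L) t‖ₑ := setLIntegral_le_lintegral _ _
    _ ≤ ∫⁻ t, ‖fderiv ℝ w (L t)‖ₑ := lintegral_mono hdL
    _ = ∫⁻ y : Ed 1, ‖fderiv ℝ w (L (y 0))‖ₑ := (hmp.lintegral_comp hm).symm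
    _ = ∫⁻ y, ‖fderiv ℝ w y‖ₑ := by simp only [hL, hx]

/-- The mass-critical Gagliardo–Nirenberg inequality for compactly supported `C¹` functions. -/
theorem exists_gagliardo_nirenberg_of_hasCompactSupport {d : ℕ} (hd : 1 ≤ d) :
    ∃ C : ℝ≥0, ∀ w : Ed d → ℂ, ContDiff ℝ 1 w → HasCompactSupport w →
      ∫⁻ x, ‖w x‖ₑ ^ (2 * (1 + 2 / (d : ℝ)))
        ≤ C * (∫⁻ x, ‖w x‖ₑ ^ 2) ^ (2 / (d : ℝ)) * ∫⁻ x, ‖fderiv ℝ w x‖ₑ ^ 2 := by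
  have hsupp : ∀ w : Ed d → ℂ, HasCompactSupport w → HasCompactSupport fun y => w y ^ 2 :=
    fun w hc => hc.comp_left (g := fun z : ℂ => z ^ 2) (by simp)
  obtain rfl | rfl | hd3 : d = 1 ∨ d = 2 ∨ 3 ≤ d := by omega
  · refine ⟨4, fun w hw hc => ?_⟩
    have hm : Measurable fun x => ‖w x‖ₑ := hw.continuous.enorm.measurable
    have hsup : ∀ x, ‖w x‖ₑ ^ 4 ≤ 4 * (∫⁻ x, ‖w x‖ₑ ^ 2) * ∫⁻ x, ‖fderiv ℝ w x‖ₑ ^ 2 := by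
      intro x
      refine le_trans ?_ (sq_lintegral_enorm_fderiv_sq_le volume hw)
      have := enorm_le_lintegral_enorm_fderiv_one (hw.pow 2) (hsupp w hc) x
      calc ‖w x‖ₑ ^ 4 = ‖w x ^ 2‖ₑ ^ 2 := by rw [enorm_pow, ← pow_mul]
        _ ≤ _ := by gcongr
    calc ∫⁻ x, ‖w x‖ₑ ^ (2 * (1 + 2 / ((1 : ℕ) : ℝ)))
        = ∫⁻ x, ‖w x‖ₑ ^ 4 * ‖w x‖ₑ ^ 2 := by
          congr 1; ext x
          rw [← pow_add, ← ENNReal.rpow_natCast]; norm_num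
      _ ≤ ∫⁻ x, (4 * (∫⁻ x, ‖w x‖ₑ ^ 2) * ∫⁻ x, ‖fderiv ℝ w x‖ₑ ^ 2) * ‖w x‖ₑ ^ 2 := by
          gcongr with x; exact hsup x
      _ = (4 * (∫⁻ x, ‖w x‖ₑ ^ 2) * ∫⁻ x, ‖fderiv ℝ w x‖ₑ ^ 2) * ∫⁻ x, ‖w x‖ₑ ^ 2 :=
          lintegral_const_mul _ (hm.pow_const 2)
      _ = _ := by
          have : (2 / ((1 : ℕ) : ℝ)) = ((2 : ℕ) : ℝ) := by norm_num
          rw [this, ENNReal.rpow_natCast]; push_cast; ring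
  · have hconj : Real.HolderConjugate (Module.finrank ℝ (Ed 2)) 2 := by
      simp only [finrank_euclideanSpace, Fintype.card_fin]
      rw [Real.holderConjugate_iff]; norm_num
    refine ⟨lintegralPowLePowLIntegralFDerivConst (volume : Measure (Ed 2)) 2 * 4,
      fun w hw hc => ?_⟩
    have h := lintegral_pow_le_pow_lintegral_fderiv volume (hw.pow 2) (hsupp w hc) hconj
    have h2 := sq_lintegral_enorm_fderiv_sq_le volume hw
    have h3 : ∀ a : ℝ≥0∞, a ^ (2 : ℝ) = a ^ 2 := fun a => by
      rw [← ENNReal.rpow_natCast]; norm_num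
    rw [h3] at h
    calc ∫⁻ x, ‖w x‖ₑ ^ (2 * (1 + 2 / ((2 : ℕ) : ℝ)))
        = ∫⁻ x, ‖w x ^ 2‖ₑ ^ (2 : ℝ) := by
          congr 1; ext x
          rw [h3, enorm_pow, ← pow_mul, ← ENNReal.rpow_natCast]; norm_num
      _ ≤ _ := h
      _ ≤ _ := mul_le_mul_right h2 _
      _ = _ := by push_cast; simp only [div_self (two_ne_zero' ℝ), ENNReal.rpow_one]; ring
  · have hd3' : (3 : ℝ) ≤ d := by exact_mod_cast hd3
    have hd0 : (0 : ℝ) < d := by linarith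
    have hd2 : (0 : ℝ) < d - 2 := by linarith
    let r : ℝ≥0 := ⟨2 * d / (d - 2), by positivity⟩
    have hr : (r : ℝ) = 2 * d / (d - 2) := rfl
    have hr0 : r ≠ 0 := by
      rw [← NNReal.coe_ne_zero, hr]; positivity
    refine ⟨SNormLESNormFDerivOfEqConst ℂ (volume : Measure (Ed d)) 2 ^ 2, fun w hw hc => ?_⟩
    have hm : Measurable fun x => ‖w x‖ₑ := hw.continuous.enorm.measurable
    have h := eLpNorm_le_eLpNorm_fderiv_of_eq (volume : Measure (Ed d)) hw hc (p := 2) (p' := r)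
      (by norm_num) (by simp; omega) (by
        simp only [finrank_euclideanSpace, Fintype.card_fin, hr]; push_cast; field_simp)
    rw [eLpNorm_nnreal_eq_lintegral hr0, eLpNorm_nnreal_eq_lintegral two_ne_zero] at h
    have hH := ENNReal.lintegral_mul_norm_pow_le (μ := (volume : Measure (Ed d)))
      (hm.pow_const 2).aemeasurable (hm.pow_const (r : ℝ)).aemeasurable
      (p := 2 / d) (q := (d - 2) / d) (by positivity) (by positivity) (by field_simp; ring)
    calc ∫⁻ x, ‖w x‖ₑ ^ (2 * (1 + 2 / (d : ℝ)))
        = ∫⁻ x, (‖w x‖ₑ ^ 2) ^ (2 / (d : ℝ)) * (‖w x‖ₑ ^ (r : ℝ)) ^ (((d : ℝ) - 2) / d) := by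
          congr 1; ext x
          rw [← ENNReal.rpow_natCast, ← ENNReal.rpow_mul, ← ENNReal.rpow_mul,
            ← ENNReal.rpow_add_of_nonneg _ _ (by positivity)
              (by rw [hr]; positivity)]
          congr 1; rw [hr]; push_cast; field_simp; ring
      _ ≤ _ := hH
      _ = (∫⁻ x, ‖w x‖ₑ ^ 2) ^ (2 / (d : ℝ))
            * ((∫⁻ x, ‖w x‖ₑ ^ (r : ℝ)) ^ (1 / (r : ℝ))) ^ 2 := by
          rw [← ENNReal.rpow_natCast (_ ^ (1 / (r : ℝ))), ← ENNReal.rpow_mul]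
          congr 2; rw [hr]; push_cast; field_simp
      _ ≤ (∫⁻ x, ‖w x‖ₑ ^ 2) ^ (2 / (d : ℝ))
            * (SNormLESNormFDerivOfEqConst ℂ (volume : Measure (Ed d)) 2
              * (∫⁻ x, ‖fderiv ℝ w x‖ₑ ^ ((2 : ℝ≥0) : ℝ)) ^ (1 / ((2 : ℝ≥0) : ℝ))) ^ 2 := by
          gcongr; exact h
      _ = _ := by
          rw [mul_pow, ← ENNReal.rpow_natCast (_ ^ (1 / ((2 : ℝ≥0) : ℝ))), ← ENNReal.rpow_mul]
          have : (1 / ((2 : ℝ≥0) : ℝ) * ((2 : ℕ) : ℝ)) = 1 := by push_cast; norm_num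
          rw [this, ENNReal.rpow_one]
          have h2 : ((2 : ℝ≥0) : ℝ) = ((2 : ℕ) : ℝ) := by push_cast; rfl
          simp only [h2, ENNReal.rpow_natCast]
          push_cast; ring

/-- Functions cut off at scale `n + 1`, with gradients controlled uniformly in `n`. -/
theorem exists_cutoff (d : ℕ) :
    ∃ (K : ℝ≥0) (χ : ℕ → Ed d → ℝ), (∀ n, ContDiff ℝ 1 (χ n)) ∧
      (∀ n, HasCompactSupport (χ n)) ∧ (∀ n x, ‖χ n x‖ ≤ 1) ∧
      (∀ n x, ‖fderiv ℝ (χ n) x‖ ≤ K) ∧ ∀ x, ∀ᶠ n in atTop, χ n x = 1 := by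
  let f : ContDiffBump (0 : Ed d) := ⟨1, 2, by norm_num, by norm_num⟩
  have hf : ContDiff ℝ 1 f := f.contDiff
  obtain ⟨K, hK⟩ := (hf.continuous_fderiv one_ne_zero).bounded_above_of_compact_support
    (f.hasCompactSupport.fderiv ℝ)
  have hK0 : 0 ≤ K := (norm_nonneg _).trans (hK 0)
  have hc : ∀ n : ℕ, ((n : ℝ) + 1)⁻¹ ≠ 0 := fun n => by positivity
  refine ⟨⟨K, hK0⟩, fun n x => f (((n : ℝ) + 1)⁻¹ • x), fun n => hf.comp (contDiff_const_smul _),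
    fun n => f.hasCompactSupport.comp_homeomorph (Homeomorph.smulOfNeZero _ (hc n)),
    fun n x => ?_, fun n x => ?_, fun x => ?_⟩
  · rw [Real.norm_of_nonneg f.nonneg]; exact f.le_one
  · rw [fderiv_comp_smul, norm_smul, Real.norm_of_nonneg (by positivity)]
    calc ((n : ℝ) + 1)⁻¹ * ‖fderiv ℝ f (((n : ℝ) + 1)⁻¹ • x)‖ ≤ 1 * K := by
          gcongr
          · exact inv_le_one_of_one_le₀ (by linarith [n.cast_nonneg (α := ℝ)])
          · exact hK _
      _ = K := one_mul K
  · filter_upwards [eventually_ge_atTop ⌈‖x‖⌉₊] with n hn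
    refine f.one_of_mem_closedBall ?_
    rw [mem_closedBall_zero_iff, norm_smul, Real.norm_of_nonneg (by positivity)]
    have : ‖x‖ ≤ n := Nat.ceil_le.mp hn
    change ((n : ℝ) + 1)⁻¹ * ‖x‖ ≤ 1
    rw [inv_mul_le_one₀ (by positivity)]
    linarith

/-- A mass-critical Gagliardo–Nirenberg inequality for functions of unit mass, without
compact support. -/
theorem exists_lintegral_rpow_le_of_mass_one {d : ℕ} (hd : 1 ≤ d) :
    ∃ C : ℝ≥0, ∀ u : Ed d → ℂ, ContDiff ℝ 1 u → ∫⁻ x, ‖u x‖ₑ ^ 2 = 1 →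
      ∫⁻ x, ‖u x‖ₑ ^ (2 * (1 + 2 / (d : ℝ))) ≤ C * (1 + ∫⁻ x, ‖fderiv ℝ u x‖ₑ ^ 2) := by
  obtain ⟨C, hC⟩ := exists_gagliardo_nirenberg_of_hasCompactSupport hd
  obtain ⟨K, χ, hχ, hχc, hχ1, hχK, hχe⟩ := exists_cutoff d
  refine ⟨C * (2 * (1 + K ^ 2)), fun u hu hmass => ?_⟩
  have hum : Measurable fun x => ‖u x‖ₑ := hu.continuous.enorm.measurable
  have hdm : Measurable fun x => ‖fderiv ℝ u x‖ₑ :=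
    (hu.continuous_fderiv one_ne_zero).enorm.measurable
  let w : ℕ → Ed d → ℂ := fun n x => χ n x • u x
  have hw : ∀ n, ContDiff ℝ 1 (w n) := fun n => (hχ n).smul hu
  have hwc : ∀ n, HasCompactSupport (w n) := fun n => (hχc n).smul_right
  have hwm : ∀ n, Measurable fun x => ‖w n x‖ₑ := fun n => (hw n).continuous.enorm.measurable
  have hle : ∀ n x, ‖w n x‖ₑ ≤ ‖u x‖ₑ := fun n x => by
    rw [enorm_le_iff_norm_le, norm_smul]
    exact mul_le_of_le_one_left (norm_nonneg _) (hχ1 n x)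
  have hmassw : ∀ n, ∫⁻ x, ‖w n x‖ₑ ^ 2 ≤ 1 := fun n => by
    rw [← hmass]; gcongr with x; exact hle n x
  have hgrad : ∀ n x, ‖fderiv ℝ (w n) x‖ₑ ^ 2
      ≤ 2 * ‖fderiv ℝ u x‖ₑ ^ 2 + 2 * K ^ 2 * ‖u x‖ₑ ^ 2 := fun n x => by
    have h1 : ‖fderiv ℝ (w n) x‖ ≤ ‖fderiv ℝ u x‖ + K * ‖u x‖ := by
      change ‖fderiv ℝ (fun y => χ n y • u y) x‖ ≤ _
      rw [fderiv_fun_smul ((hχ n).differentiable one_ne_zero x) (hu.differentiable one_ne_zero x)]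
      refine (norm_add_le _ _).trans (add_le_add ?_ ?_)
      · rw [norm_smul]; exact mul_le_of_le_one_left (norm_nonneg _) (hχ1 n x)
      · rw [ContinuousLinearMap.norm_smulRight_apply]; gcongr; exact hχK n x
    have h2 : ‖fderiv ℝ (w n) x‖ ^ 2 ≤ 2 * ‖fderiv ℝ u x‖ ^ 2 + 2 * K ^ 2 * ‖u x‖ ^ 2 := by
      have := pow_le_pow_left₀ (norm_nonneg _) h1 2
      nlinarith [sq_nonneg (‖fderiv ℝ u x‖ - K * ‖u x‖)]
    simp only [enorm_eq_nnnorm]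
    exact_mod_cast h2
  have hT : ∀ n, ∫⁻ x, ‖fderiv ℝ (w n) x‖ₑ ^ 2
      ≤ 2 * (1 + K ^ 2) * (1 + ∫⁻ x, ‖fderiv ℝ u x‖ₑ ^ 2) := fun n => by
    calc ∫⁻ x, ‖fderiv ℝ (w n) x‖ₑ ^ 2
        ≤ ∫⁻ x, (2 * ‖fderiv ℝ u x‖ₑ ^ 2 + 2 * K ^ 2 * ‖u x‖ₑ ^ 2) := lintegral_mono (hgrad n)
      _ = 2 * (∫⁻ x, ‖fderiv ℝ u x‖ₑ ^ 2) + 2 * K ^ 2 := by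
        rw [lintegral_add_left (by fun_prop), lintegral_const_mul _ (by fun_prop),
          lintegral_const_mul _ (by fun_prop), hmass, mul_one]
      _ ≤ 2 * (∫⁻ x, ‖fderiv ℝ u x‖ₑ ^ 2) + 2 * K ^ 2
            + (2 + 2 * K ^ 2 * ∫⁻ x, ‖fderiv ℝ u x‖ₑ ^ 2) := le_self_add
      _ = _ := by ring
  have hbound : ∀ n, ∫⁻ x, ‖w n x‖ₑ ^ (2 * (1 + 2 / (d : ℝ)))
      ≤ (C * (2 * (1 + K ^ 2)) : ℝ≥0) * (1 + ∫⁻ x, ‖fderiv ℝ u x‖ₑ ^ 2) := fun n => by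
    calc _ ≤ _ := hC (w n) (hw n) (hwc n)
      _ ≤ C * 1 * (2 * (1 + K ^ 2) * (1 + ∫⁻ x, ‖fderiv ℝ u x‖ₑ ^ 2)) := by
        gcongr
        · exact ENNReal.rpow_le_one (hmassw n) (by positivity)
        · exact hT n
      _ = _ := by push_cast; ring
  have hlim : ∀ x, liminf (fun n => ‖w n x‖ₑ ^ (2 * (1 + 2 / (d : ℝ)))) atTop
      = ‖u x‖ₑ ^ (2 * (1 + 2 / (d : ℝ))) := fun x => by
    refine Tendsto.liminf_eq (tendsto_const_nhds.congr' ?_)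
    filter_upwards [hχe x] with n hn
    simp [w, hn]
  calc ∫⁻ x, ‖u x‖ₑ ^ (2 * (1 + 2 / (d : ℝ)))
      = ∫⁻ x, liminf (fun n => ‖w n x‖ₑ ^ (2 * (1 + 2 / (d : ℝ)))) atTop := by simp only [hlim]
    _ ≤ liminf (fun n => ∫⁻ x, ‖w n x‖ₑ ^ (2 * (1 + 2 / (d : ℝ)))) atTop :=
      lintegral_liminf_le fun n => (hwm n).pow_const _
    _ ≤ _ := liminf_le_of_frequently_le' (Frequently.of_forall hbound)

/-- Young-type interpolation of an intermediate power between `s` and `s ^ q`. -/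
theorem exists_rpow_le_mul_add_mul_rpow {p q δ : ℝ} (hp : 1 < p) (hpq : p < q) (hδ : 0 < δ) :
    ∃ K : ℝ, 0 ≤ K ∧ ∀ s : ℝ, 0 ≤ s → s ^ p ≤ K * s + δ * s ^ q := by
  let M : ℝ := δ⁻¹ ^ (q - p)⁻¹
  have hM : 0 < M := by positivity
  have hMq : M ^ (q - p) = δ⁻¹ := by
    rw [← Real.rpow_mul (by positivity), inv_mul_cancel₀ (by linarith), Real.rpow_one]
  refine ⟨M ^ (p - 1), by positivity, fun s hs => ?_⟩
  rcases le_total s M with h | h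
  · have : s ^ p = s ^ (p - 1) * s := by
      rw [← Real.rpow_add_one' hs (by linarith)]; ring_nf
    rw [this]
    have h1 : s ^ (p - 1) ≤ M ^ (p - 1) := Real.rpow_le_rpow hs h (by linarith)
    have h2 : 0 ≤ δ * s ^ q := by positivity
    nlinarith
  · have hs0 : 0 < s := hM.trans_le h
    have h1 : δ⁻¹ ≤ s ^ (q - p) := hMq ▸ Real.rpow_le_rpow hM.le h (by linarith)
    have h2 : s ^ q = s ^ p * s ^ (q - p) := by rw [← Real.rpow_add hs0]; ring_nf
    have h3 : 1 ≤ δ * s ^ (q - p) := by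
      calc (1 : ℝ) = δ * δ⁻¹ := (mul_inv_cancel₀ hδ.ne').symm
        _ ≤ _ := by gcongr
    have h4 : 0 ≤ M ^ (p - 1) * s := by positivity
    have h5 : 0 ≤ s ^ p := by positivity
    rw [h2]; nlinarith

/-- The energies attained by functions of mass `lam`. -/
def energySet (d : ℕ) (p lam : ℝ) : Set ℝ :=
  { e : ℝ | ∃ u : Ed d → ℂ, ContDiff ℝ 1 u ∧
    Integrable (fun x : Ed d => ‖u x‖ ^ 2) ∧
    Integrable (fun x : Ed d => ‖fderiv ℝ u x‖ ^ 2) ∧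
    (∫ x : Ed d, ‖u x‖ ^ 2) = lam ∧
    e = (∫ x : Ed d, ‖fderiv ℝ u x‖ ^ 2)
        - (1 / p) * ∫ x : Ed d, ‖u x‖ ^ (2 * p) }

theorem Infimum1_eq_sInf_energySet (d : ℕ) (p lam : ℝ) :
    Infimum1 d p lam = sInf (energySet d p lam) := rfl

/-- In the mass-subcritical regime the energy is bounded below on functions of unit mass. -/
theorem bddBelow_energySet_one {d : ℕ} (hd : 1 ≤ d) {p : ℝ} (hp1 : 1 < p)
    (hp2 : p < 1 + 2 / d) : BddBelow (energySet d p 1) := by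
  obtain ⟨C, hC⟩ := exists_lintegral_rpow_le_of_mass_one hd
  obtain ⟨K, hK0, hK⟩ := exists_rpow_le_mul_add_mul_rpow hp1 hp2
    (δ := ((C : ℝ) + 1)⁻¹) (by positivity)
  refine ⟨-(K + 1), ?_⟩
  rintro e ⟨u, hu, hu2, hT, hmass, rfl⟩
  set q : ℝ := 1 + 2 / (d : ℝ) with hq
  have hq0 : 0 < q := by linarith
  set T := ∫ x : Ed d, ‖fderiv ℝ u x‖ ^ 2 with hTdef
  have hT0 : 0 ≤ T := integral_nonneg fun x => by positivity
  have hmassE : ∫⁻ x, ‖u x‖ₑ ^ 2 = 1 := by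
    rw [← ENNReal.ofReal_one, ← hmass, ofReal_integral_eq_lintegral_ofReal hu2
      (ae_of_all _ fun x => by positivity)]
    simp [ENNReal.ofReal_pow]
  have hTE : ∫⁻ x, ‖fderiv ℝ u x‖ₑ ^ 2 = ENNReal.ofReal T := by
    rw [hTdef, ofReal_integral_eq_lintegral_ofReal hT (ae_of_all _ fun x => by positivity)]
    simp [ENNReal.ofReal_pow]
  have hQE : ∫⁻ x, ENNReal.ofReal (‖u x‖ ^ (2 * q)) ≤ ENNReal.ofReal (C * (1 + T)) := by
    have h := hC u hu hmassE
    rw [hTE] at h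
    convert h using 1
    · congr 1; ext x
      rw [← ENNReal.ofReal_rpow_of_nonneg (norm_nonneg _) (by positivity), ofReal_norm]
    · rw [ENNReal.ofReal_mul (by positivity), ENNReal.ofReal_add one_pos.le hT0]
      simp
  have hcont : Continuous fun x => ‖u x‖ ^ (2 * q) :=
    hu.continuous.norm.rpow_const fun x => Or.inr (by positivity)
  have hQi : Integrable fun x => ‖u x‖ ^ (2 * q) := by
    refine ⟨hcont.aestronglyMeasurable, ?_⟩
    rw [hasFiniteIntegral_iff_ofReal (ae_of_all _ fun x => by positivity)]
    exact hQE.trans_lt ENNReal.ofReal_lt_top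
  have hQ : ∫ x, ‖u x‖ ^ (2 * q) ≤ C * (1 + T) := by
    rw [integral_eq_lintegral_of_nonneg_ae (ae_of_all _ fun x => by positivity)
      hcont.aestronglyMeasurable]
    exact ENNReal.toReal_le_of_le_ofReal (by positivity) hQE
  have hsplit : ∀ s a : ℝ, 0 ≤ s → s ^ (2 * a) = (s ^ 2) ^ a := fun s a hs => by
    rw [Real.rpow_mul hs]; norm_num
  have hP : ∫ x, ‖u x‖ ^ (2 * p) ≤ K + T + 1 := by
    calc ∫ x, ‖u x‖ ^ (2 * p)
        ≤ ∫ x, (K * ‖u x‖ ^ 2 + ((C : ℝ) + 1)⁻¹ * ‖u x‖ ^ (2 * q)) := by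
          refine integral_mono_of_nonneg (ae_of_all _ fun x => by positivity)
            ((hu2.const_mul _).add (hQi.const_mul _)) (ae_of_all _ fun x => ?_)
          simp only [hsplit _ _ (norm_nonneg (u x))]
          exact hK _ (by positivity)
      _ = K + ((C : ℝ) + 1)⁻¹ * ∫ x, ‖u x‖ ^ (2 * q) := by
          rw [integral_add (hu2.const_mul _) (hQi.const_mul _), integral_const_mul,
            integral_const_mul, hmass, mul_one]
      _ ≤ K + ((C : ℝ) + 1)⁻¹ * (((C : ℝ) + 1) * (1 + T)) := by
          gcongr
          refine hQ.trans ?_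
          gcongr
          linarith
      _ = K + T + 1 := by field_simp; ring
  have hpinv : 1 / p ≤ 1 := by rw [div_le_one (by linarith)]; exact hp1.le
  have h1 : (1 / p) * ∫ x, ‖u x‖ ^ (2 * p) ≤ 1 * (K + T + 1) := by
    gcongr
  linarith

/-- The dilations that rescale kinetic and potential energy by the same factor. -/
theorem mul_mem_energySet {d : ℕ} {p lam A e : ℝ} (hA : 0 < A) (he : e ∈ energySet d p lam) :
    A ^ (2 * p - d * (p - 1)) * e ∈ energySet d p (A ^ (2 - d * (p - 1)) * lam) := by
  obtain ⟨u, hu, hu2, hT, hmass, rfl⟩ := he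
  let B : ℝ := A ^ (p - 1)
  have hB : 0 < B := by positivity
  have hBd : |(B ^ Module.finrank ℝ (Ed d))⁻¹| = A ^ (-(d * (p - 1))) := by
    rw [finrank_euclideanSpace, Fintype.card_fin, abs_of_pos (by positivity),
      ← Real.rpow_mul_natCast hA.le, ← Real.rpow_neg hA.le]
    ring_nf
  have hnorm : ∀ x, ‖A • u (B • x)‖ = A * ‖u (B • x)‖ := fun x => by
    rw [norm_smul, Real.norm_of_nonneg hA.le]
  have hfd : ∀ x, ‖fderiv ℝ (fun y => A • u (B • y)) x‖ = A * B * ‖fderiv ℝ u (B • x)‖ := by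
    intro x
    have h1 : DifferentiableAt ℝ (fun y => u (B • y)) x :=
      (hu.differentiable one_ne_zero).comp (differentiable_id.const_smul B) x
    rw [fderiv_fun_const_smul h1, fderiv_comp_smul, norm_smul, norm_smul,
      Real.norm_of_nonneg hA.le, Real.norm_of_nonneg hB.le, mul_assoc]
  refine ⟨fun x => A • u (B • x), (hu.comp (contDiff_const_smul B)).const_smul A, ?_, ?_, ?_, ?_⟩
  · simp only [hnorm, mul_pow]
    exact (hu2.comp_smul hB.ne').const_mul _
  · simp only [hfd, mul_pow]
    exact (hT.comp_smul hB.ne').const_mul _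
  · simp only [hnorm, mul_pow]
    rw [integral_const_mul, Measure.integral_comp_smul volume (fun x => ‖u x‖ ^ 2), hBd, hmass,
      smul_eq_mul, ← mul_assoc, ← Real.rpow_natCast, ← Real.rpow_add hA]
    norm_num [sub_eq_add_neg]
  · simp only [hnorm, hfd, mul_pow, Real.mul_rpow hA.le (norm_nonneg _)]
    rw [integral_const_mul, integral_const_mul,
      Measure.integral_comp_smul volume (fun x => ‖fderiv ℝ u x‖ ^ 2),
      Measure.integral_comp_smul volume (fun x => ‖u x‖ ^ (2 * p)), hBd, smul_eq_mul, smul_eq_mul]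
    have hAB : A ^ 2 * B ^ 2 = A ^ (2 * p) := by
      rw [← Real.rpow_mul_natCast hA.le, ← Real.rpow_natCast, ← Real.rpow_add hA]
      push_cast; ring_nf
    rw [hAB, sub_eq_add_neg (2 * p), Real.rpow_add hA]
    ring

theorem exists_neg_mem_energySet {d : ℕ} {p : ℝ} (hp : 1 < p) :
    ∃ lam > 0, ∃ e ∈ energySet d p lam, e < 0 := by
  obtain ⟨u, hu, hc, hu0⟩ : ∃ u : Ed d → ℂ, ContDiff ℝ 1 u ∧ HasCompactSupport u ∧ u 0 = 1 := by
    let f : ContDiffBump (0 : Ed d) := ⟨1, 2, by norm_num, by norm_num⟩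
    refine ⟨fun x => (f x : ℂ), Complex.ofRealCLM.contDiff.comp f.contDiff,
      f.hasCompactSupport.comp_left (g := Complex.ofReal) (by simp), ?_⟩
    change ((f 0 : ℝ) : ℂ) = 1
    rw [f.one_of_mem_closedBall (by simp [f.rIn_pos.le]), Complex.ofReal_one]
  have hpos : ∀ a : ℝ, 0 < a → Integrable (fun x => ‖u x‖ ^ a) ∧ 0 < ∫ x, ‖u x‖ ^ a := by
    intro a ha
    have hcont : Continuous fun x => ‖u x‖ ^ a :=
      hu.continuous.norm.rpow_const fun x => Or.inr ha.le
    have hcs : HasCompactSupport fun x => ‖u x‖ ^ a :=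
      hc.comp_left (g := fun z : ℂ => ‖z‖ ^ a) (by simp [ha.ne'])
    refine ⟨hcont.integrable_of_hasCompactSupport hcs, ?_⟩
    refine hcont.integral_pos_of_hasCompactSupport_nonneg_nonzero hcs
      (fun x => by positivity) (x := 0) (by simp [hu0])
  obtain ⟨hm, hm0⟩ := hpos 2 two_pos
  obtain ⟨-, hP0⟩ := hpos (2 * p) (by linarith)
  simp only [Real.rpow_two] at hm hm0
  have hTi : Integrable fun x => ‖fderiv ℝ u x‖ ^ 2 := by
    have hcs : HasCompactSupport fun x => ‖fderiv ℝ u x‖ ^ 2 := by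
      refine (hc.fderiv ℝ).mono fun x hx => ?_
      simp only [Function.mem_support] at hx ⊢
      exact fun h => hx (by rw [h, norm_zero, zero_pow two_ne_zero])
    have hcont : Continuous fun x => ‖fderiv ℝ u x‖ ^ 2 :=
      (hu.continuous_fderiv one_ne_zero).norm.pow 2
    exact hcont.integrable_of_hasCompactSupport hcs
  obtain ⟨P, hP⟩ : ∃ P, P = ∫ x, ‖u x‖ ^ (2 * p) := ⟨_, rfl⟩
  obtain ⟨T, hT⟩ : ∃ T, T = ∫ x, ‖fderiv ℝ u x‖ ^ 2 := ⟨_, rfl⟩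
  rw [← hP] at hP0
  obtain ⟨A, hA, hA0⟩ : ∃ A : ℝ, p * T / P < A ^ (2 * p - 2) ∧ 0 < A :=
    (((tendsto_rpow_atTop (by linarith : 0 < 2 * p - 2)).eventually_gt_atTop _).and
      (eventually_gt_atTop 0)).exists
  have hnorm : ∀ x, ‖A • u x‖ = A * ‖u x‖ := fun x => by
    rw [norm_smul, Real.norm_of_nonneg hA0.le]
  have hfd : ∀ x, ‖fderiv ℝ (fun y => A • u y) x‖ = A * ‖fderiv ℝ u x‖ := fun x => by
    rw [fderiv_fun_const_smul (hu.differentiable one_ne_zero x), norm_smul,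
      Real.norm_of_nonneg hA0.le]
  refine ⟨A ^ 2 * ∫ x, ‖u x‖ ^ 2, by positivity, _,
    ⟨fun x => A • u x, hu.const_smul A, ?_, ?_, ?_, rfl⟩, ?_⟩
  · simp only [hnorm, mul_pow]; exact hm.const_mul _
  · simp only [hfd, mul_pow]; exact hTi.const_mul _
  · simp only [hnorm, mul_pow]; exact integral_const_mul _ _
  · simp only [hnorm, hfd, mul_pow, Real.mul_rpow hA0.le (norm_nonneg _)]
    rw [integral_const_mul, integral_const_mul, ← hP, ← hT]
    have hAp : A ^ (2 * p) = A ^ 2 * A ^ (2 * p - 2) := by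
      rw [← Real.rpow_natCast, ← Real.rpow_add hA0]; push_cast; ring_nf
    have hp0 : 0 < p := by linarith
    rw [div_lt_iff₀ hP0] at hA
    have h1 : T < 1 / p * (A ^ (2 * p - 2) * P) := by
      rw [one_div, ← div_eq_inv_mul, lt_div_iff₀ hp0]; linarith
    have h2 : 0 < A ^ 2 := by positivity
    rw [hAp]
    nlinarith

open scoped Pointwise in
/-- The energies at mass `lam` are those at mass `1`, scaled by a power of `lam`. -/
theorem energySet_eq_smul {d : ℕ} (hd : 1 ≤ d) {p : ℝ} (hp2 : p < 1 + 2 / d) {lam : ℝ}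
    (hlam : 0 < lam) :
    energySet d p lam
      = lam ^ (1 + (2 / d) * (p - 1) / (1 + 2 / d - p)) • energySet d p 1 := by
  have hd0 : (0 : ℝ) < d := by exact_mod_cast hd
  have hc : 0 < 2 - d * (p - 1) := by
    have : d * p < d * (1 + 2 / d) := mul_lt_mul_of_pos_left hp2 hd0
    have h2 : (d : ℝ) * (1 + 2 / d) = d + 2 := by field_simp
    linarith
  have hθ : 1 + (2 / d) * (p - 1) / (1 + 2 / d - p)
      = (2 - d * (p - 1))⁻¹ * (2 * p - d * (p - 1)) := by
    have h3 : 1 + 2 / d - p = (2 - d * (p - 1)) / d := by field_simp; ring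
    rw [h3]; field_simp; ring
  set θ := 1 + (2 / (d : ℝ)) * (p - 1) / (1 + 2 / d - p)
  have key : ∀ {m c e : ℝ}, 0 < c → e ∈ energySet d p m → c ^ θ * e ∈ energySet d p (c * m) := by
    intro m c e hc0 he
    have h := mul_mem_energySet (A := c ^ (2 - d * (p - 1))⁻¹) (by positivity) he
    rwa [← Real.rpow_mul hc0.le, ← Real.rpow_mul hc0.le, ← hθ, inv_mul_cancel₀ hc.ne',
      Real.rpow_one] at h
  ext e
  rw [Set.mem_smul_set_iff_inv_smul_mem₀ (by positivity), smul_eq_mul, ← Real.inv_rpow hlam.le]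
  constructor
  · intro he
    have := key (inv_pos.mpr hlam) he
    rwa [inv_mul_cancel₀ hlam.ne'] at this
  · intro he
    have := key hlam he
    rwa [mul_one, ← mul_assoc, ← Real.mul_rpow hlam.le (by positivity), mul_inv_cancel₀ hlam.ne',
      Real.one_rpow, one_mul] at this

/-- Strict superadditivity of `t ↦ t ^ θ` for `θ > 1`. -/
theorem rpow_add_rpow_lt_rpow_add {θ a b : ℝ} (hθ : 1 < θ) (ha : 0 < a) (hb : 0 < b) :
    a ^ θ + b ^ θ < (a + b) ^ θ := by
  have hsplit : ∀ t : ℝ, 0 < t → t ^ θ = t * t ^ (θ - 1) := fun t ht => by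
    rw [← Real.rpow_one_add' ht.le (by linarith)]; ring_nf
  have h1 : a ^ (θ - 1) < (a + b) ^ (θ - 1) :=
    Real.rpow_lt_rpow ha.le (by linarith) (by linarith)
  have h2 : b ^ (θ - 1) < (a + b) ^ (θ - 1) :=
    Real.rpow_lt_rpow hb.le (by linarith) (by linarith)
  rw [hsplit a ha, hsplit b hb, hsplit (a + b) (by linarith)]
  nlinarith

end EnergyScaling

/-- the scaling identity `I(λ) = I(1)·λ^θ` with
`θ = 1 + (2/d)(p−1)/(1+2/d−p) > 1`, negativity of `I(1)`, and the strict
binding inequalities for `I`. -/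
theorem statement3 (d : ℕ) (hd : 1 ≤ d) (p : ℝ) (hp1 : 1 < p)
    (hp2 : p < 1 + 2 / d) :
    (1 : ℝ) < 1 + (2 / d) * (p - 1) / (1 + 2 / d - p) ∧
    (∀ lam : ℝ, 0 < lam →
      Infimum1 d p lam
        = Infimum1 d p 1 * lam ^ (1 + (2 / d) * (p - 1) / (1 + 2 / d - p))) ∧
    Infimum1 d p 1 < 0 ∧
    (∀ lam lam' : ℝ, 0 < lam' → lam' < lam →
      Infimum1 d p lam < Infimum1 d p (lam - lam') + Infimum1 d p lam') := by
  have hd0 : (0 : ℝ) < d := by exact_mod_cast hd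
  have hθ : (1 : ℝ) < 1 + (2 / d) * (p - 1) / (1 + 2 / d - p) := by
    have h1 : 0 < p - 1 := by linarith
    have h2 : 0 < 1 + 2 / d - p := by linarith
    have : 0 < (2 / d) * (p - 1) / (1 + 2 / d - p) := by positivity
    linarith
  have hscale : ∀ lam : ℝ, 0 < lam → Infimum1 d p lam
      = Infimum1 d p 1 * lam ^ (1 + (2 / d) * (p - 1) / (1 + 2 / d - p)) := fun lam hlam => by
    rw [Infimum1_eq_sInf_energySet, energySet_eq_smul hd hp2 hlam,
      Real.sInf_smul_of_nonneg (by positivity), smul_eq_mul, mul_comm,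
      ← Infimum1_eq_sInf_energySet]
  have hneg : Infimum1 d p 1 < 0 := by
    obtain ⟨lam, hlam, e, he, he0⟩ := exists_neg_mem_energySet (d := d) hp1
    rw [energySet_eq_smul hd hp2 hlam] at he
    obtain ⟨e', he', rfl⟩ := he
    refine (csInf_le (bddBelow_energySet_one hd hp1 hp2) he').trans_lt ?_
    exact neg_of_mul_neg_right he0 (by positivity)
  refine ⟨hθ, hscale, hneg, fun lam lam' h0 hlt => ?_⟩
  rw [hscale lam (h0.trans hlt), hscale lam' h0, hscale (lam - lam') (by linarith), ← mul_add]
  refine mul_lt_mul_of_neg_left ?_ hneg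
  simpa using rpow_add_rpow_lt_rpow_add hθ (sub_pos.mpr hlt) h0
end
end

section
/- Let d ≥ 1 and 1 < p < 1 + 2/d. There exists a constant C > 0, depending only on d and p, such that for all real λ > 0 one has −Cλ ≤ J(λ) < 0. -/
open MeasureTheory Real Filter Topology

noncomputable section

open scoped ENNReal

theorem sq_lintegral_le_measure_mul_lintegral_sq {α : Type*} [MeasurableSpace α] (μ : Measure α)
    {f : α → ℝ≥0∞} (hf : AEMeasurable f μ) :
    (∫⁻ a, f a ∂μ) ^ 2 ≤ μ Set.univ * ∫⁻ a, f a ^ 2 ∂μ := by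
  have h := ENNReal.lintegral_mul_le_Lp_mul_Lq μ Real.HolderConjugate.two_two
    (aemeasurable_const (b := (1 : ℝ≥0∞))) hf
  simp only [Pi.mul_apply, one_mul, one_pow, lintegral_const, ENNReal.rpow_two] at h
  calc (∫⁻ a, f a ∂μ) ^ 2
      ≤ ((μ Set.univ) ^ (1 / 2 : ℝ) * (∫⁻ a, f a ^ 2 ∂μ) ^ (1 / 2 : ℝ)) ^ 2 := by gcongr
    _ = μ Set.univ * ∫⁻ a, f a ^ 2 ∂μ := by
      rw [mul_pow, ← ENNReal.rpow_two, ← ENNReal.rpow_two, ← ENNReal.rpow_mul, ← ENNReal.rpow_mul]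
      norm_num

theorem enorm_add_sq_le (a b : ℂ) : ‖a + b‖ₑ ^ 2 ≤ 2 * ‖a‖ₑ ^ 2 + 2 * ‖b‖ₑ ^ 2 := by
  have h : ‖a + b‖ ^ 2 ≤ 2 * ‖a‖ ^ 2 + 2 * ‖b‖ ^ 2 := by
    have := norm_add_le a b
    nlinarith [norm_nonneg (a + b), norm_nonneg a, norm_nonneg b, sq_nonneg (‖a‖ - ‖b‖)]
  have := ENNReal.ofReal_le_ofReal h
  rw [ENNReal.ofReal_add (by positivity) (by positivity), ENNReal.ofReal_mul (by norm_num),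
    ENNReal.ofReal_mul (by norm_num)] at this
  simpa [ENNReal.ofReal_pow] using this

theorem enorm_sub_sq_le_lintegral_fderiv {d : ℕ} {u : Ed d → ℂ} (hu : ContDiff ℝ 1 u)
    (x h : Ed d) :
    ‖u (x + h) - u x‖ₑ ^ 2 ≤
      ‖h‖ₑ ^ 2 * ∫⁻ t in Set.Ioc (0 : ℝ) 1, ‖fderiv ℝ u (x + t • h)‖ₑ ^ 2 := by
  have hd : ∀ t : ℝ, HasDerivAt (fun t : ℝ => u (x + t • h)) (fderiv ℝ u (x + t • h) h) t := by
    intro t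
    have h1 : HasDerivAt (fun t : ℝ => x + t • h) h t := by
      simpa using ((hasDerivAt_id t).smul_const h).const_add x
    exact ((hu.differentiable (by norm_num)) _).hasFDerivAt.comp_hasDerivAt t h1
  have hc : Continuous fun t : ℝ => fderiv ℝ u (x + t • h) := by
    have := hu.continuous_fderiv (by norm_num)
    fun_prop
  have hc2 : Continuous fun t : ℝ => fderiv ℝ u (x + t • h) h := by fun_prop
  have hI := intervalIntegral.integral_eq_sub_of_hasDerivAt (a := 0) (b := 1)
    (fun t _ => hd t) (hc2.intervalIntegrable _ _)
  simp only [one_smul, zero_smul, add_zero] at hI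
  rw [← hI, intervalIntegral.integral_of_le zero_le_one]
  calc ‖∫ t in Set.Ioc (0 : ℝ) 1, fderiv ℝ u (x + t • h) h‖ₑ ^ 2
      ≤ (∫⁻ t in Set.Ioc (0 : ℝ) 1, ‖h‖ₑ * ‖fderiv ℝ u (x + t • h)‖ₑ) ^ 2 := by
        gcongr
        refine (enorm_integral_le_lintegral_enorm _).trans (lintegral_mono fun t => ?_)
        rw [mul_comm]
        exact ContinuousLinearMap.le_opENorm _ _
    _ ≤ _ := by
        refine (sq_lintegral_le_measure_mul_lintegral_sq _ ?_).trans_eq ?_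
        · exact (hc.enorm.measurable.const_mul _).aemeasurable
        · simp only [mul_pow]
          rw [lintegral_const_mul]
          · simp
          · exact (hc.enorm.measurable).pow_const 2

theorem lintegral_translate_sub_sq_le {d : ℕ} {u : Ed d → ℂ} (hu : ContDiff ℝ 1 u) (h : Ed d) :
    ∫⁻ x, ‖u (x + h) - u x‖ₑ ^ 2 ≤ ‖h‖ₑ ^ 2 * ∫⁻ x, ‖fderiv ℝ u x‖ₑ ^ 2 := by
  have hc := hu.continuous_fderiv (by norm_num)
  have hm : Measurable fun z : Ed d × ℝ => ‖fderiv ℝ u (z.1 + z.2 • h)‖ₑ ^ 2 := by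
    have : Continuous fun z : Ed d × ℝ => fderiv ℝ u (z.1 + z.2 • h) := by fun_prop
    exact this.enorm.measurable.pow_const 2
  refine (lintegral_mono fun x => enorm_sub_sq_le_lintegral_fderiv hu x h).trans_eq ?_
  rw [lintegral_const_mul _ (Measurable.lintegral_prod_right' hm)]
  congr 1
  rw [lintegral_lintegral_swap hm.aemeasurable]
  have : ∀ t : ℝ, ∫⁻ x, ‖fderiv ℝ u (x + t • h)‖ₑ ^ 2 = ∫⁻ x, ‖fderiv ℝ u x‖ₑ ^ 2 :=
    fun t => lintegral_add_right_eq_self (fun x => ‖fderiv ℝ u x‖ₑ ^ 2) (t • h)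
  simp [this]

theorem Admissible.memLp {d N : ℕ} {u : Fin N → Ed d → ℂ} (hu : Admissible d N u) (n : Fin N) :
    MemLp (u n) 2 volume :=
  (memLp_two_iff_integrable_sq_norm (hu.contDiff n).continuous.aestronglyMeasurable).2 (hu.sqInt n)

theorem Admissible.orthonormal_toLp {d N : ℕ} {u : Fin N → Ed d → ℂ} (hu : Admissible d N u) :
    Orthonormal ℂ fun n => (hu.memLp n).toLp (u n) := by
  rw [orthonormal_iff_ite]
  intro i j
  rw [L2.inner_def]
  have : ∫ x, inner ℂ ((hu.memLp i).toLp (u i) x) ((hu.memLp j).toLp (u j) x) =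
      ∫ x, u j x * (starRingEnd ℂ) (u i x) := by
    refine integral_congr_ae ?_
    filter_upwards [(hu.memLp i).coeFn_toLp, (hu.memLp j).coeFn_toLp] with x hi hj
    rw [hi, hj, RCLike.inner_apply]
  rw [this, hu.orthonormal]
  simp [eq_comm]

theorem Admissible.sum_sq_setIntegral_le {d N : ℕ} {u : Fin N → Ed d → ℂ} (hu : Admissible d N u)
    {s : Set (Ed d)} (hs : MeasurableSet s) (hs' : volume s ≠ ∞) :
    ∑ n, ‖∫ y in s, u n y‖ₑ ^ 2 ≤ volume s := by
  have h := hu.orthonormal_toLp.sum_inner_products_le (s := Finset.univ)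
    (indicatorConstLp 2 hs hs' (1 : ℂ))
  rw [norm_indicatorConstLp (by norm_num) (by norm_num)] at h
  have h2 : ∀ n, ‖inner ℂ ((hu.memLp n).toLp (u n)) (indicatorConstLp 2 hs hs' (1 : ℂ))‖ =
      ‖∫ y in s, u n y‖ := by
    intro n
    rw [norm_inner_symm, L2.inner_indicatorConstLp_one]
    congr 1
    exact integral_congr_ae (ae_restrict_of_ae (hu.memLp n).coeFn_toLp)
  simp only [h2] at h
  have h3 : (‖(1 : ℂ)‖ * volume.real s ^ (1 / (2 : ℝ≥0∞).toReal)) ^ 2 = volume.real s := by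
    rw [norm_one, one_mul, ← Real.rpow_natCast, ← Real.rpow_mul measureReal_nonneg]
    norm_num
  rw [h3] at h
  have h4 := ENNReal.ofReal_le_ofReal h
  rw [ENNReal.ofReal_sum_of_nonneg (fun _ _ => by positivity)] at h4
  simpa [ENNReal.ofReal_pow, measureReal_def, ENNReal.ofReal_toReal hs'] using h4

theorem setIntegral_ball_zero_add {d : ℕ} (u : Ed d → ℂ) (x : Ed d) (r : ℝ) :
    ∫ h in Metric.ball 0 r, u (x + h) = ∫ y in Metric.ball x r, u y := by
  rw [← integral_indicator measurableSet_ball, ← integral_indicator measurableSet_ball,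
    ← integral_add_left_eq_self ((Metric.ball x r).indicator u) x]
  congr 1
  ext h
  simp [Set.indicator, dist_eq_norm]

/-- Comparison of a function with its mean over a ball. -/
theorem measure_sq_mul_enorm_sq_le {d : ℕ} {u : Ed d → ℂ} (hu : Continuous u) (x : Ed d) (r : ℝ) :
    volume (Metric.ball (0 : Ed d) r) ^ 2 * ‖u x‖ₑ ^ 2 ≤
      2 * ‖∫ y in Metric.ball x r, u y‖ₑ ^ 2 + 2 * (volume (Metric.ball (0 : Ed d) r) *
        ∫⁻ h in Metric.ball 0 r, ‖u (x + h) - u x‖ₑ ^ 2) := by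
  have hV : volume (Metric.ball (0 : Ed d) r) ≠ ∞ := measure_ball_lt_top.ne
  have hi : IntegrableOn (fun h => u (x + h)) (Metric.ball 0 r) :=
    ((show Continuous fun h => u (x + h) by fun_prop).continuousOn.integrableOn_compact
      (isCompact_closedBall 0 r)).mono_set Metric.ball_subset_closedBall
  have hc : IntegrableOn (fun _ => u x) (Metric.ball (0 : Ed d) r) := integrableOn_const hV
  have key : (volume.real (Metric.ball (0 : Ed d) r) : ℂ) * u x =
      (∫ y in Metric.ball x r, u y) + -∫ h in Metric.ball 0 r, (u (x + h) - u x) := by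
    rw [integral_sub hi hc, setIntegral_ball_zero_add, setIntegral_const]
    simp
  calc volume (Metric.ball (0 : Ed d) r) ^ 2 * ‖u x‖ₑ ^ 2
      = ‖(volume.real (Metric.ball (0 : Ed d) r) : ℂ) * u x‖ₑ ^ 2 := by
        rw [enorm_mul, mul_pow, ← ofReal_norm (volume.real _ : ℂ), Complex.norm_real,
          Real.norm_of_nonneg measureReal_nonneg, measureReal_def, ENNReal.ofReal_toReal hV]
    _ ≤ _ := by
        rw [key]
        refine (enorm_add_sq_le _ _).trans ?_
        rw [enorm_neg]
        gcongr
        refine (pow_le_pow_left' (enorm_integral_le_lintegral_enorm _) 2).trans ?_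
        refine (sq_lintegral_le_measure_mul_lintegral_sq _ ?_).trans_eq ?_
        · exact (show Continuous fun h => u (x + h) - u x by fun_prop).enorm.measurable.aemeasurable
        · simp

theorem lintegral_ball_translate_sub_sq_le {d : ℕ} {u : Ed d → ℂ} (hu : ContDiff ℝ 1 u) (r : ℝ) :
    ∫⁻ x, ∫⁻ h in Metric.ball 0 r, ‖u (x + h) - u x‖ₑ ^ 2 ≤
      volume (Metric.ball (0 : Ed d) r) * (ENNReal.ofReal r ^ 2 * ∫⁻ x, ‖fderiv ℝ u x‖ₑ ^ 2) := by
  have hc := hu.continuous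
  have hm : Measurable fun z : Ed d × Ed d => ‖u (z.1 + z.2) - u z.1‖ₑ ^ 2 :=
    (show Continuous fun z : Ed d × Ed d => u (z.1 + z.2) - u z.1 by
      fun_prop).enorm.measurable.pow_const 2
  rw [lintegral_lintegral_swap hm.aemeasurable]
  calc _ ≤ ∫⁻ _ in Metric.ball (0 : Ed d) r, ENNReal.ofReal r ^ 2 * ∫⁻ x, ‖fderiv ℝ u x‖ₑ ^ 2 := by
        refine setLIntegral_mono measurable_const fun h hh => ?_
        refine (lintegral_translate_sub_sq_le hu h).trans ?_
        gcongr
        rw [← ofReal_norm]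
        exact ENNReal.ofReal_le_ofReal (mem_ball_zero_iff.1 hh).le
    _ = _ := by simp [mul_comm]

/-- The mean-square oscillation `∑ₙ wₙ ∫_{|h| < r} |uₙ(x + h) - uₙ(x)|² dh`. -/
def ballOscillation {d N : ℕ} (w : Fin N → ℝ≥0∞) (u : Fin N → Ed d → ℂ) (r : ℝ) (x : Ed d) : ℝ≥0∞ :=
  ∑ n, w n * ∫⁻ h in Metric.ball 0 r, ‖u n (x + h) - u n x‖ₑ ^ 2

theorem measurable_lintegral_translate_sub_sq {d : ℕ} {u : Ed d → ℂ} (hu : Continuous u) (r : ℝ) :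
    Measurable fun x => ∫⁻ h in Metric.ball 0 r, ‖u (x + h) - u x‖ₑ ^ 2 :=
  Measurable.lintegral_prod_right' (f := fun z : Ed d × Ed d => ‖u (z.1 + z.2) - u z.1‖ₑ ^ 2)
    ((show Continuous fun z : Ed d × Ed d => u (z.1 + z.2) - u z.1 by
      fun_prop).enorm.measurable.pow_const 2)

theorem Admissible.measurable_ballOscillation {d N : ℕ} {u : Fin N → Ed d → ℂ}
    (hu : Admissible d N u) (w : Fin N → ℝ≥0∞) (r : ℝ) : Measurable (ballOscillation w u r) :=
  Finset.measurable_fun_sum _ fun n _ =>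
    (measurable_lintegral_translate_sub_sq (hu.contDiff n).continuous r).const_mul _

theorem Admissible.lintegral_ballOscillation_le {d N : ℕ} {u : Fin N → Ed d → ℂ}
    (hu : Admissible d N u) (w : Fin N → ℝ≥0∞) (r : ℝ) :
    ∫⁻ x, ballOscillation w u r x ≤ volume (Metric.ball (0 : Ed d) r) *
      (ENNReal.ofReal r ^ 2 * ∑ n, w n * ∫⁻ x, ‖fderiv ℝ (u n) x‖ₑ ^ 2) := by
  have hm n := measurable_lintegral_translate_sub_sq (hu.contDiff n).continuous r
  simp only [ballOscillation]
  rw [lintegral_finsetSum _ fun n _ => (hm n).const_mul _, Finset.mul_sum, Finset.mul_sum]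
  refine Finset.sum_le_sum fun n _ => ?_
  rw [lintegral_const_mul _ (hm n)]
  calc _ ≤ _ := mul_le_mul_right (lintegral_ball_translate_sub_sq_le (hu.contDiff n) r) _
    _ = _ := by ring

/-- Bessel's inequality bounds the density, up to the oscillation at scale `r`. -/
theorem Admissible.measure_mul_density_le {d N : ℕ} {u : Fin N → Ed d → ℂ}
    (hu : Admissible d N u) {w : Fin N → ℝ≥0∞} (hw : ∀ n, w n ≤ 1) {r : ℝ} (hr : 0 < r)
    (x : Ed d) :
    volume (Metric.ball (0 : Ed d) r) * ∑ n, w n * ‖u n x‖ₑ ^ 2 ≤ 2 + 2 * ballOscillation w u r x := by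
  set V := volume (Metric.ball (0 : Ed d) r) with hV
  have hVt : V ≠ ∞ := measure_ball_lt_top.ne
  have hV0 : V ≠ 0 := (Metric.measure_ball_pos volume _ hr).ne'
  have hB := hu.sum_sq_setIntegral_le (measurableSet_ball (x := x) (ε := r)) measure_ball_lt_top.ne
  rw [Measure.addHaar_ball_center, ← hV] at hB
  refine (ENNReal.mul_le_mul_iff_right hV0 hVt).1 ?_
  calc V * (V * ∑ n, w n * ‖u n x‖ₑ ^ 2) = ∑ n, w n * (V ^ 2 * ‖u n x‖ₑ ^ 2) := by
        simp only [Finset.mul_sum]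
        refine Finset.sum_congr rfl fun n _ => by ring
    _ ≤ ∑ n, (2 * ‖∫ y in Metric.ball x r, u n y‖ₑ ^ 2 + 2 * V * (w n *
          ∫⁻ h in Metric.ball 0 r, ‖u n (x + h) - u n x‖ₑ ^ 2)) := by
        refine Finset.sum_le_sum fun n _ => ?_
        calc _ ≤ _ := mul_le_mul_right
                (measure_sq_mul_enorm_sq_le (hu.contDiff n).continuous x r) _
          _ = w n * (2 * ‖∫ y in Metric.ball x r, u n y‖ₑ ^ 2) + 2 * V * (w n *
                ∫⁻ h in Metric.ball 0 r, ‖u n (x + h) - u n x‖ₑ ^ 2) := by rw [← hV]; ring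
          _ ≤ _ := by
            exact add_le_add_left (mul_le_of_le_one_left' (hw n)) _
    _ = 2 * ∑ n, ‖∫ y in Metric.ball x r, u n y‖ₑ ^ 2 + 2 * V * ballOscillation w u r x := by
        rw [Finset.sum_add_distrib, ← Finset.mul_sum, ← Finset.mul_sum, ballOscillation]
    _ ≤ 2 * V + 2 * V * ballOscillation w u r x := by gcongr
    _ = V * (2 + 2 * ballOscillation w u r x) := by ring

theorem Admissible.density_le_of_large {d N : ℕ} {u : Fin N → Ed d → ℂ}
    (hu : Admissible d N u) {w : Fin N → ℝ≥0∞} (hw : ∀ n, w n ≤ 1) {r : ℝ} (hr : 0 < r)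
    {x : Ed d} (hx : 4 / volume (Metric.ball (0 : Ed d) r) ≤ ∑ n, w n * ‖u n x‖ₑ ^ 2) :
    ∑ n, w n * ‖u n x‖ₑ ^ 2 ≤
      4 / volume (Metric.ball (0 : Ed d) r) * ballOscillation w u r x := by
  have h := hu.measure_mul_density_le hw hr x
  have hVt : volume (Metric.ball (0 : Ed d) r) ≠ ∞ := measure_ball_lt_top.ne
  have hV0 : volume (Metric.ball (0 : Ed d) r) ≠ 0 := (Metric.measure_ball_pos volume _ hr).ne'
  have hRt : ∑ n, w n * ‖u n x‖ₑ ^ 2 ≠ ∞ := by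
    refine (ENNReal.sum_lt_top.2 fun n _ => ?_).ne
    exact ENNReal.mul_lt_top ((hw n).trans_lt ENNReal.one_lt_top) (by simp)
  generalize volume (Metric.ball (0 : Ed d) r) = V at *
  generalize ∑ n, w n * ‖u n x‖ₑ ^ 2 = R at *
  generalize ballOscillation w u r x = D at *
  rw [ENNReal.div_le_iff hV0 hVt] at hx
  rw [mul_comm, ← mul_div_assoc, ENNReal.le_div_iff_mul_le (.inl hV0) (.inl hVt)]
  rcases eq_or_ne D ∞ with rfl | hD
  · simp
  lift V to NNReal using hVt
  lift R to NNReal using hRt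
  lift D to NNReal using hD
  norm_cast at *
  have h' : (V * R : ℝ) ≤ 2 + 2 * D := mod_cast h
  have hx' : (4 : ℝ) ≤ R * V := mod_cast hx
  have : (R * V : ℝ) ≤ D * 4 := by nlinarith
  exact_mod_cast this

theorem rpow_le_add_tsum_of_levels {a : ℝ≥0∞} (ha : a ≠ 0) (ha' : a ≠ ∞) {q : ℝ} (hq : 0 < q)
    {M F : ℕ → ℝ≥0∞} (hM : ∃ k, a ≤ M k) (hF : ∀ k, M k ≤ a → a ≤ F k) :
    a ^ (1 + q) ≤ M 0 ^ q * a + ∑' k, M (k + 1) ^ q * F k := by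
  classical
  have hpow : a ^ (1 + q) = a ^ q * a := by
    rw [add_comm, ENNReal.rpow_add _ _ ha ha', ENNReal.rpow_one]
  rw [hpow]
  obtain hk | ⟨j, hj⟩ : Nat.find hM = 0 ∨ ∃ j, Nat.find hM = j + 1 :=
    (Nat.eq_zero_or_eq_succ_pred _).imp_right fun h => ⟨_, h⟩
  · have : a ≤ M 0 := hk ▸ Nat.find_spec hM
    exact le_add_right (by gcongr)
  · have h1 : a ≤ M (j + 1) := hj ▸ Nat.find_spec hM
    have h2 : ¬ a ≤ M j := Nat.find_min hM (by lia)
    refine le_add_left (le_trans ?_ (ENNReal.le_tsum j))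
    gcongr
    exact hF j (not_le.1 h2).le

theorem four_div_volume_ball_pow {d : ℕ} (k : ℕ) :
    4 / volume (Metric.ball (0 : Ed d) ((1 / 2) ^ k)) =
      ENNReal.ofReal (4 / volume.real (Metric.ball (0 : Ed d) 1) * (2 ^ d) ^ k) := by
  have hVt : volume (Metric.ball (0 : Ed d) 1) ≠ ∞ := measure_ball_lt_top.ne
  have hV0 : 0 < volume.real (Metric.ball (0 : Ed d) 1) :=
    ENNReal.toReal_pos (Metric.measure_ball_pos volume _ one_pos).ne' hVt
  rw [Measure.addHaar_ball_of_pos _ _ (by positivity), finrank_euclideanSpace_fin,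
    ← ofReal_measureReal hVt, ← ENNReal.ofReal_mul (by positivity),
    show (4 : ℝ≥0∞) = ENNReal.ofReal 4 by simp, ← ENNReal.ofReal_div_of_pos (by positivity)]
  congr 1
  rw [← pow_mul, ← pow_mul, mul_comm k d, one_div, inv_pow]
  field_simp

/-- A subcritical Lieb-Thirring inequality with arbitrarily small kinetic term. -/
theorem exists_lintegral_density_rpow_le {d : ℕ} (hd : 1 ≤ d) {q : ℝ} (hq : 0 < q) (hdq : d * q < 2) :
    ∃ C : ℝ, 0 < C ∧ ∀ (N : ℕ) (u : Fin N → Ed d → ℂ), Admissible d N u →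
      ∀ w : Fin N → ℝ≥0∞, (∀ n, w n ≤ 1) →
      ∫⁻ x, (∑ n, w n * ‖u n x‖ₑ ^ 2) ^ (1 + q) ≤
        ENNReal.ofReal C * (∫⁻ x, ∑ n, w n * ‖u n x‖ₑ ^ 2) +
          ∑ n, w n * ∫⁻ x, ‖fderiv ℝ (u n) x‖ₑ ^ 2 := by
  set m : ℝ := 4 / volume.real (Metric.ball (0 : Ed d) 1) with hm
  have hV0 : 0 < volume.real (Metric.ball (0 : Ed d) 1) :=
    ENNReal.toReal_pos (Metric.measure_ball_pos volume _ one_pos).ne' measure_ball_lt_top.ne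
  have hm0 : 0 < m := by positivity
  set b : ℝ := (2 ^ d) ^ q / 4 with hb
  have hb0 : 0 < b := by positivity
  have hb1 : b < 1 := by
    rw [hb, div_lt_one (by norm_num), ← Real.rpow_natCast, ← Real.rpow_mul (by norm_num)]
    calc (2 : ℝ) ^ (d * q) < 2 ^ (2 : ℝ) := Real.rpow_lt_rpow_of_exponent_lt (by norm_num) hdq
      _ = 4 := by norm_num
  set A : ℝ := 4 * (m * 2 ^ d) ^ q with hA
  have hA0 : 0 < A := by positivity
  obtain ⟨K, hK⟩ : ∃ K : ℕ, b ^ K < (1 - b) / A :=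
    exists_pow_lt_of_lt_one (div_pos (sub_pos.2 hb1) hA0) hb1
  refine ⟨(m * (2 ^ d) ^ K) ^ q, by positivity, fun N u hu w hw => ?_⟩
  set T := ∑ n, w n * ∫⁻ x, ‖fderiv ℝ (u n) x‖ₑ ^ 2 with hT
  set R : Ed d → ℝ≥0∞ := fun x => ∑ n, w n * ‖u n x‖ₑ ^ 2 with hR
  set M : ℕ → ℝ≥0∞ := fun k => ENNReal.ofReal (m * (2 ^ d) ^ (K + k)) with hM
  have hRm : Measurable R := Finset.measurable_fun_sum _ fun n _ =>
    ((hu.contDiff n).continuous.enorm.measurable.pow_const 2).const_mul _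
  have hMV k : 4 / volume (Metric.ball (0 : Ed d) ((1 / 2) ^ (K + k))) = M k :=
    four_div_volume_ball_pow _
  have hRt x : R x ≠ ∞ := by
    refine (ENNReal.sum_lt_top.2 fun n _ => ?_).ne
    exact ENNReal.mul_lt_top ((hw n).trans_lt ENNReal.one_lt_top) (by simp)
  have hpt x : R x ^ (1 + q) ≤ M 0 ^ q * R x +
      ∑' k, M (k + 1) ^ q * (M k * ballOscillation w u ((1 / 2) ^ (K + k)) x) := by
    rcases eq_or_ne (R x) 0 with h0 | h0
    · rw [h0, ENNReal.zero_rpow_of_pos (by positivity)]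
      exact zero_le
    refine rpow_le_add_tsum_of_levels h0 (hRt x) hq ?_ fun k hk => ?_
    · obtain ⟨k, hk⟩ := pow_unbounded_of_one_lt ((R x).toReal / m)
        (show (1 : ℝ) < 2 ^ d from one_lt_pow₀ (by norm_num) (by lia))
      refine ⟨k, (ENNReal.le_ofReal_iff_toReal_le (hRt x) (by positivity)).2 ?_⟩
      rw [div_lt_iff₀' hm0] at hk
      refine hk.le.trans ?_
      gcongr
      · exact one_le_pow₀ (by norm_num)
      · lia
    · rw [← hMV] at hk ⊢
      exact hu.density_le_of_large hw (by positivity) hk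
  have hterm k : M (k + 1) ^ q * (M k * ∫⁻ x, ballOscillation w u ((1 / 2) ^ (K + k)) x) ≤
      ENNReal.ofReal (A * b ^ K * b ^ k) * T := by
    set r : ℝ := (1 / 2) ^ (K + k) with hr
    have hVt : volume (Metric.ball (0 : Ed d) r) ≠ ∞ := measure_ball_lt_top.ne
    have hVz : volume (Metric.ball (0 : Ed d) r) ≠ 0 :=
      (Metric.measure_ball_pos volume _ (by positivity)).ne'
    calc _ ≤ M (k + 1) ^ q * (M k * (volume (Metric.ball (0 : Ed d) r) *
          (ENNReal.ofReal r ^ 2 * T))) := by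
          gcongr
          exact hu.lintegral_ballOscillation_le w r
      _ = M (k + 1) ^ q * (4 * ENNReal.ofReal r ^ 2) * T := by
          rw [← hMV k, ← mul_assoc (4 / _), ENNReal.div_mul_cancel hVz hVt]
          ring
      _ = _ := by
          congr 1
          rw [hM, ENNReal.ofReal_rpow_of_nonneg (by positivity) hq.le,
            show (4 : ℝ≥0∞) = ENNReal.ofReal 4 by simp, ← ENNReal.ofReal_pow (by positivity),
            ← ENNReal.ofReal_mul (by positivity), ← ENNReal.ofReal_mul (by positivity)]
          congr 1
          have e1 : m * (2 ^ d) ^ (K + (k + 1)) = (m * 2 ^ d) * (2 ^ d) ^ (K + k) := by ring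
          have e2 : (((2 : ℝ) ^ d) ^ (K + k)) ^ q = ((2 ^ d) ^ q) ^ (K + k) := by
            rw [← Real.rpow_natCast, ← Real.rpow_mul (by positivity), mul_comm,
              Real.rpow_mul (by positivity), Real.rpow_natCast]
          have e3 : r ^ 2 = (1 / 4) ^ (K + k) := by
            rw [hr, ← pow_mul, mul_comm, pow_mul]; norm_num
          rw [e1, Real.mul_rpow (by positivity) (by positivity), e2, e3, mul_assoc A, ← pow_add,
            hb, hA, div_eq_mul_one_div, mul_pow]
          ring
  calc ∫⁻ x, R x ^ (1 + q)
      ≤ ∫⁻ x, (M 0 ^ q * R x +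
          ∑' k, M (k + 1) ^ q * (M k * ballOscillation w u ((1 / 2) ^ (K + k)) x)) :=
        lintegral_mono hpt
    _ = M 0 ^ q * (∫⁻ x, R x) +
          ∑' k, M (k + 1) ^ q * (M k * ∫⁻ x, ballOscillation w u ((1 / 2) ^ (K + k)) x) := by
        have ho k := hu.measurable_ballOscillation w ((1 / 2) ^ (K + k))
        rw [lintegral_add_left (hRm.const_mul _), lintegral_const_mul _ hRm,
          lintegral_tsum fun k => (((ho k).const_mul _).const_mul _).aemeasurable]
        congr 2
        ext k
        rw [lintegral_const_mul _ ((ho k).const_mul _), lintegral_const_mul _ (ho k)]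
    _ ≤ M 0 ^ q * (∫⁻ x, R x) + ∑' k, ENNReal.ofReal (A * b ^ K * b ^ k) * T := by
        exact add_le_add_right (ENNReal.tsum_le_tsum hterm) _
    _ ≤ _ := by
        have hg : ∑' k : ℕ, ENNReal.ofReal (A * b ^ K * b ^ k) ≤ 1 := by
          have hs := (summable_geometric_of_lt_one hb0.le hb1).mul_left (A * b ^ K)
          rw [← ENNReal.ofReal_tsum_of_nonneg (fun k => by positivity) hs, tsum_mul_left,
            tsum_geometric_of_lt_one hb0.le hb1, ENNReal.ofReal_le_one, ← div_eq_mul_inv,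
            div_le_one (sub_pos.2 hb1)]
          rw [lt_div_iff₀ hA0] at hK
          linarith
        rw [ENNReal.tsum_mul_right, hM, ENNReal.ofReal_rpow_of_nonneg (by positivity) hq.le]
        exact add_le_add_right (mul_le_of_le_one_left' hg) _

theorem wt_pos {lam : ℝ} (hlam : 0 < lam) (n : Fin ⌈lam⌉₊) : 0 < wt ⌈lam⌉₊ lam n := by
  have := Nat.ceil_lt_add_one hlam.le
  unfold wt
  split_ifs
  · linarith
  · exact one_pos

theorem wt_le_one (lam : ℝ) (n : Fin ⌈lam⌉₊) : wt ⌈lam⌉₊ lam n ≤ 1 := by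
  have := Nat.le_ceil lam
  unfold wt
  split_ifs
  · linarith
  · exact le_rfl

theorem sum_wt {lam : ℝ} (hlam : 0 < lam) : ∑ n, wt ⌈lam⌉₊ lam n = lam := by
  have hN : 0 < ⌈lam⌉₊ := Nat.ceil_pos.2 hlam
  generalize ⌈lam⌉₊ = N at *
  obtain ⟨m, rfl⟩ := Nat.exists_eq_succ_of_ne_zero hN.ne'
  have h : ∀ i : Fin m, (i : ℕ) ≠ m := fun i => i.2.ne
  rw [Fin.sum_univ_castSucc]
  simp only [wt, Nat.succ_eq_add_one, Fin.val_castSucc, Fin.val_last, add_tsub_cancel_right, h,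
    if_false, if_true, Finset.sum_const, Finset.card_univ, Fintype.card_fin, nsmul_eq_mul]
  push_cast
  ring

theorem Integrable.lintegral_enorm_sq {α F : Type*} [MeasurableSpace α] {μ : Measure α}
    [NormedAddCommGroup F] {f : α → F} (hf : Integrable (fun x => ‖f x‖ ^ 2) μ) :
    ∫⁻ x, ‖f x‖ₑ ^ 2 ∂μ = ENNReal.ofReal (∫ x, ‖f x‖ ^ 2 ∂μ) := by
  rw [ofReal_integral_eq_lintegral_ofReal hf (ae_of_all _ fun x => by positivity)]
  simp [ENNReal.ofReal_pow]

theorem Admissible.integral_norm_sq {d N : ℕ} {u : Fin N → Ed d → ℂ} (hu : Admissible d N u)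
    (n : Fin N) : ∫ x, ‖u n x‖ ^ 2 = 1 := by
  have h := hu.orthonormal n n
  simp only [Complex.mul_conj', if_true] at h
  exact_mod_cast h

section

variable {d : ℕ} {lam : ℝ} {u : Fin ⌈lam⌉₊ → Ed d → ℂ}

theorem densityW_nonneg (hlam : 0 < lam) (x : Ed d) : 0 ≤ densityW d ⌈lam⌉₊ lam u x :=
  Finset.sum_nonneg fun n _ => mul_nonneg (wt_pos hlam n).le (by positivity)

theorem kineticW_nonneg (hlam : 0 < lam) : 0 ≤ kineticW d ⌈lam⌉₊ lam u :=
  Finset.sum_nonneg fun n _ => mul_nonneg (wt_pos hlam n).le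
    (integral_nonneg fun x => by positivity)

theorem Admissible.continuous_densityW (hu : Admissible d ⌈lam⌉₊ u) :
    Continuous (densityW d ⌈lam⌉₊ lam u) := by
  have := fun n => (hu.contDiff n).continuous
  unfold densityW
  fun_prop

theorem ofReal_densityW (hlam : 0 < lam) (x : Ed d) :
    ENNReal.ofReal (densityW d ⌈lam⌉₊ lam u x) =
      ∑ n, ENNReal.ofReal (wt ⌈lam⌉₊ lam n) * ‖u n x‖ₑ ^ 2 := by
  rw [densityW, ENNReal.ofReal_sum_of_nonneg
    fun n _ => mul_nonneg (wt_pos hlam n).le (by positivity)]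
  refine Finset.sum_congr rfl fun n _ => ?_
  rw [ENNReal.ofReal_mul (wt_pos hlam n).le]
  simp [ENNReal.ofReal_pow]

theorem Admissible.ofReal_kineticW (hu : Admissible d ⌈lam⌉₊ u) (hlam : 0 < lam) :
    ENNReal.ofReal (kineticW d ⌈lam⌉₊ lam u) =
      ∑ n, ENNReal.ofReal (wt ⌈lam⌉₊ lam n) * ∫⁻ x, ‖fderiv ℝ (u n) x‖ₑ ^ 2 := by
  rw [kineticW, ENNReal.ofReal_sum_of_nonneg fun n _ => mul_nonneg (wt_pos hlam n).le
    (integral_nonneg fun x => by positivity)]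
  refine Finset.sum_congr rfl fun n _ => ?_
  rw [ENNReal.ofReal_mul (wt_pos hlam n).le, Integrable.lintegral_enorm_sq (hu.gradSqInt n)]

theorem Admissible.lintegral_densityW (hu : Admissible d ⌈lam⌉₊ u) (hlam : 0 < lam) :
    ∫⁻ x, ∑ n, ENNReal.ofReal (wt ⌈lam⌉₊ lam n) * ‖u n x‖ₑ ^ 2 = ENNReal.ofReal lam := by
  have hm n : Measurable fun x => ‖u n x‖ₑ ^ 2 :=
    (hu.contDiff n).continuous.enorm.measurable.pow_const 2
  rw [lintegral_finsetSum _ fun n _ => (hm n).const_mul _]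
  simp only [lintegral_const_mul _ (hm _), Integrable.lintegral_enorm_sq (hu.sqInt _),
    hu.integral_norm_sq, ENNReal.ofReal_one, mul_one]
  rw [← ENNReal.ofReal_sum_of_nonneg fun n _ => (wt_pos hlam n).le, sum_wt hlam]

end

theorem exists_integral_densityW_rpow_le {d : ℕ} (hd : 1 ≤ d) {p : ℝ} (hp1 : 1 < p)
    (hp2 : p < 1 + 2 / d) :
    ∃ C : ℝ, 0 < C ∧ ∀ (lam : ℝ), 0 < lam → ∀ u : Fin ⌈lam⌉₊ → Ed d → ℂ, Admissible d ⌈lam⌉₊ u →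
      Integrable (fun x => densityW d ⌈lam⌉₊ lam u x ^ p) ∧
      ∫ x, densityW d ⌈lam⌉₊ lam u x ^ p ≤ C * lam + kineticW d ⌈lam⌉₊ lam u := by
  have hd0 : (0 : ℝ) < d := by exact_mod_cast hd
  have hdq : d * (p - 1) < 2 := by
    have : p - 1 < 2 / d := by linarith
    rwa [lt_div_iff₀' hd0] at this
  obtain ⟨C, hC, h⟩ := exists_lintegral_density_rpow_le hd (sub_pos.2 hp1) hdq
  refine ⟨C, hC, fun lam hlam u hu => ?_⟩
  have hK := kineticW_nonneg (u := u) hlam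
  have h1 := h _ u hu (fun n => ENNReal.ofReal (wt ⌈lam⌉₊ lam n))
    fun n => ENNReal.ofReal_le_one.2 (wt_le_one lam n)
  rw [hu.lintegral_densityW hlam, ← hu.ofReal_kineticW hlam, ← ENNReal.ofReal_mul hC.le,
    ← ENNReal.ofReal_add (by positivity) hK] at h1
  simp only [← ofReal_densityW hlam, add_sub_cancel] at h1
  simp only [ENNReal.ofReal_rpow_of_nonneg (densityW_nonneg hlam _) (zero_le_one.trans hp1.le)]
    at h1
  have h0 : 0 ≤ᵐ[volume] fun x => densityW d ⌈lam⌉₊ lam u x ^ p :=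
    ae_of_all _ fun x => Real.rpow_nonneg (densityW_nonneg hlam x) p
  have hm : AEStronglyMeasurable (fun x => densityW d ⌈lam⌉₊ lam u x ^ p) volume :=
    (hu.continuous_densityW.rpow_const fun _ => Or.inr (by linarith)).aestronglyMeasurable
  refine ⟨(lintegral_ofReal_ne_top_iff_integrable hm h0).1
    (h1.trans_lt ENNReal.ofReal_lt_top).ne, ?_⟩
  rw [integral_eq_lintegral_of_nonneg_ae h0 hm]
  exact ENNReal.toReal_le_of_le_ofReal (by positivity) h1

theorem Admissible.integral_densityW_rpow_pos {d : ℕ} {lam p : ℝ} {u : Fin ⌈lam⌉₊ → Ed d → ℂ}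
    (hu : Admissible d ⌈lam⌉₊ u) (hlam : 0 < lam) (hp : 0 < p)
    (hi : Integrable (fun x => densityW d ⌈lam⌉₊ lam u x ^ p)) :
    0 < ∫ x, densityW d ⌈lam⌉₊ lam u x ^ p := by
  have hcont : Continuous fun x => densityW d ⌈lam⌉₊ lam u x ^ p :=
    hu.continuous_densityW.rpow_const fun _ => Or.inr hp.le
  let n : Fin ⌈lam⌉₊ := ⟨0, Nat.ceil_pos.2 hlam⟩
  obtain ⟨x, hx⟩ : ∃ x, u n x ≠ 0 := by
    by_contra! h
    simpa [h] using hu.integral_norm_sq n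
  rw [integral_pos_iff_support_of_nonneg
    (fun x => Real.rpow_nonneg (densityW_nonneg hlam x) p) hi]
  refine hcont.isOpen_support.measure_pos _ ⟨x, ?_⟩
  refine (Real.rpow_pos_of_pos ?_ p).ne'
  refine Finset.sum_pos' (fun n _ => mul_nonneg (wt_pos hlam n).le (by positivity))
    ⟨n, Finset.mem_univ _, mul_pos (wt_pos hlam n) (by positivity)⟩

/-- The `L²`-normalized dilation `x ↦ s^(d/2) u(s x)`. -/
def dilate {d N : ℕ} (s : ℝ) (u : Fin N → Ed d → ℂ) (n : Fin N) (x : Ed d) : ℂ :=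
  (s ^ ((d : ℝ) / 2)) • u n (s • x)

section

variable {d N : ℕ} {s : ℝ} {u : Fin N → Ed d → ℂ}

theorem sq_rpow_half (hs : 0 < s) : (s ^ ((d : ℝ) / 2)) ^ 2 = s ^ d := by
  rw [← Real.rpow_natCast, ← Real.rpow_mul hs.le]
  simp

theorem norm_dilate_sq (hs : 0 < s) (n : Fin N) (x : Ed d) :
    ‖dilate s u n x‖ ^ 2 = s ^ d * ‖u n (s • x)‖ ^ 2 := by
  rw [dilate, norm_smul, mul_pow, Real.norm_eq_abs, sq_abs, sq_rpow_half hs]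

theorem norm_fderiv_dilate_sq (hs : 0 < s) (hu : Admissible d N u) (n : Fin N) (x : Ed d) :
    ‖fderiv ℝ (dilate s u n) x‖ ^ 2 = s ^ d * s ^ 2 * ‖fderiv ℝ (u n) (s • x)‖ ^ 2 := by
  have hdiff : DifferentiableAt ℝ (fun x => u n (s • x)) x := by
    have := (hu.contDiff n).differentiable (by norm_num)
    fun_prop
  have : fderiv ℝ (dilate s u n) x = (s ^ ((d : ℝ) / 2)) • s • fderiv ℝ (u n) (s • x) := by
    rw [← fderiv_comp_smul]
    exact fderiv_fun_const_smul hdiff _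
  rw [this, norm_smul, norm_smul, mul_pow, mul_pow, Real.norm_eq_abs, Real.norm_eq_abs, sq_abs,
    sq_abs, sq_rpow_half hs, mul_assoc]

theorem integral_comp_smul_Ed {F : Type*} [NormedAddCommGroup F] [NormedSpace ℝ F] (hs : 0 < s)
    (f : Ed d → F) : ∫ x, f (s • x) = (s ^ d)⁻¹ • ∫ x, f x := by
  rw [Measure.integral_comp_smul, finrank_euclideanSpace_fin, abs_of_pos (by positivity)]

theorem Admissible.dilate (hu : Admissible d N u) (hs : 0 < s) : Admissible d N (dilate s u) where
  contDiff n := by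
    have := hu.contDiff n
    unfold _root_.dilate
    fun_prop
  sqInt n := by
    simp only [norm_dilate_sq hs]
    exact ((hu.sqInt n).comp_smul hs.ne').const_mul _
  gradSqInt n := by
    simp only [norm_fderiv_dilate_sq hs hu]
    exact ((hu.gradSqInt n).comp_smul hs.ne').const_mul _
  orthonormal j k := by
    have h : ∀ x, _root_.dilate s u j x * (starRingEnd ℂ) (_root_.dilate s u k x) =
        (s ^ d : ℝ) • (u j (s • x) * (starRingEnd ℂ) (u k (s • x))) := by
      intro x
      rw [← sq_rpow_half hs]
      simp only [_root_.dilate, Complex.real_smul, map_mul, Complex.conj_ofReal]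
      push_cast
      ring
    simp only [h]
    rw [integral_smul, integral_comp_smul_Ed hs
      (fun x => u j x * (starRingEnd ℂ) (u k x)), hu.orthonormal, smul_smul,
      mul_inv_cancel₀ (by positivity), one_smul]

theorem kineticW_dilate (hu : Admissible d N u) (hs : 0 < s) (lam : ℝ) :
    kineticW d N lam (dilate s u) = s ^ 2 * kineticW d N lam u := by
  rw [kineticW, kineticW, Finset.mul_sum]
  refine Finset.sum_congr rfl fun n _ => ?_
  simp only [norm_fderiv_dilate_sq hs hu]
  rw [integral_const_mul, integral_comp_smul_Ed hs (fun x => ‖fderiv ℝ (u n) x‖ ^ 2), smul_eq_mul]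
  field_simp

theorem densityW_dilate (hs : 0 < s) (lam : ℝ) (x : Ed d) :
    densityW d N lam (dilate s u) x = s ^ d * densityW d N lam u (s • x) := by
  simp only [densityW, Finset.mul_sum, norm_dilate_sq hs]
  exact Finset.sum_congr rfl fun n _ => by ring

theorem integral_densityW_dilate_rpow {lam : ℝ} {u : Fin ⌈lam⌉₊ → Ed d → ℂ} (hlam : 0 < lam)
    (hs : 0 < s) (p : ℝ) :
    ∫ x, densityW d ⌈lam⌉₊ lam (dilate s u) x ^ p =
      s ^ (d * (p - 1)) * ∫ x, densityW d ⌈lam⌉₊ lam u x ^ p := by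
  have h : ∀ x, densityW d ⌈lam⌉₊ lam (dilate s u) x ^ p =
      (s ^ d) ^ p * densityW d ⌈lam⌉₊ lam u (s • x) ^ p := fun x => by
    rw [densityW_dilate hs, Real.mul_rpow (by positivity) (densityW_nonneg hlam _)]
  simp only [h]
  rw [integral_const_mul, integral_comp_smul_Ed hs (fun x => densityW d ⌈lam⌉₊ lam u x ^ p),
    smul_eq_mul, ← mul_assoc]
  congr 1
  rw [mul_sub, mul_one, Real.rpow_sub hs, Real.rpow_mul hs.le, Real.rpow_natCast, div_eq_mul_inv]

end

/-- Spreading out an admissible tuple makes its energy negative. -/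
theorem Admissible.exists_energyW_dilate_neg {d : ℕ} {lam p : ℝ} {u : Fin ⌈lam⌉₊ → Ed d → ℂ}
    (hu : Admissible d ⌈lam⌉₊ u) (hlam : 0 < lam) (hp : 0 < p) (hdp : d * (p - 1) < 2)
    (hi : Integrable (fun x => densityW d ⌈lam⌉₊ lam u x ^ p)) :
    ∃ s : ℝ, 0 < s ∧ energyW d ⌈lam⌉₊ p lam (_root_.dilate s u) < 0 := by
  have hP := hu.integral_densityW_rpow_pos hlam hp hi
  have hT := kineticW_nonneg (u := u) hlam
  set P := ∫ x, densityW d ⌈lam⌉₊ lam u x ^ p with hPdef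
  set T := kineticW d ⌈lam⌉₊ lam u with hTdef
  set e := 2 - d * (p - 1) with he
  have he0 : 0 < e := by linarith
  set a := P / (p * (T + 1)) with ha
  have ha0 : 0 < a := by positivity
  have hs : 0 < a ^ e⁻¹ := by positivity
  refine ⟨a ^ e⁻¹, hs, ?_⟩
  rw [energyW, kineticW_dilate hu hs, integral_densityW_dilate_rpow hlam hs, ← hPdef, ← hTdef]
  have h2 : (a ^ e⁻¹) ^ 2 = (a ^ e⁻¹) ^ (d * (p - 1)) * a := by
    nth_rw 3 [← Real.rpow_inv_rpow ha0.le he0.ne']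
    rw [← Real.rpow_add hs, he, add_sub_cancel, Real.rpow_two]
  rw [h2]
  have h3 : a * T < 1 / p * P := by
    rw [ha, div_mul_eq_mul_div, div_lt_iff₀ (by positivity)]
    field_simp
    linarith
  have h4 : 0 < (a ^ e⁻¹) ^ (d * (p - 1)) := by positivity
  nlinarith

theorem exists_normalized_bump (d : ℕ) :
    ∃ v : Ed d → ℂ, ContDiff ℝ 1 v ∧ HasCompactSupport v ∧ (∀ x, 2 ≤ ‖x‖ → v x = 0) ∧
      ∫ x, v x * (starRingEnd ℂ) (v x) = 1 := by
  let f : ContDiffBump (0 : Ed d) := ⟨1, 2, one_pos, one_lt_two⟩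
  have hf : ContDiff ℝ 1 (f : Ed d → ℝ) := f.contDiff
  have hcs : HasCompactSupport (f : Ed d → ℝ) := f.hasCompactSupport
  have hI : 0 < ∫ x, f x ^ 2 := by
    have hc : Continuous fun x => f x ^ 2 := by fun_prop
    refine hc.integral_pos_of_hasCompactSupport_nonneg_nonzero (x := 0) ?_
      (fun x => by positivity) ?_
    · exact hcs.comp_left (g := fun t : ℝ => t ^ 2) (by simp)
    · simp [f.one_of_mem_closedBall (Metric.mem_closedBall_self f.rIn_pos.le)]
  refine ⟨fun x => ((√(∫ x, f x ^ 2))⁻¹ * f x : ℝ),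
    Complex.ofRealCLM.contDiff.comp (contDiff_const.mul hf),
    hcs.comp_left (g := fun t : ℝ => (((√(∫ x, f x ^ 2))⁻¹ * t : ℝ) : ℂ)) (by simp),
    fun x hx => ?_, ?_⟩
  · have : f x = 0 := f.zero_of_le_dist (by simpa [f] using hx)
    simp [this]
  · have (x : Ed d) : (((√(∫ x, f x ^ 2))⁻¹ * f x : ℝ) : ℂ) *
        (starRingEnd ℂ) (((√(∫ x, f x ^ 2))⁻¹ * f x : ℝ) : ℂ) =
        (((∫ x, f x ^ 2)⁻¹ * f x ^ 2 : ℝ) : ℂ) := by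
      rw [Complex.conj_ofReal, ← Complex.ofReal_mul, ← sq, mul_pow, inv_pow, Real.sq_sqrt hI.le]
    simp only [this]
    rw [integral_complex_ofReal, integral_const_mul, inv_mul_cancel₀ hI.ne', Complex.ofReal_one]

theorem exists_admissible {d : ℕ} (hd : 1 ≤ d) (N : ℕ) : ∃ u, Admissible d N u := by
  obtain ⟨v, hv, hvs, hv0, hv1⟩ := exists_normalized_bump d
  let c : Fin N → Ed d := fun n => EuclideanSpace.single ⟨0, hd⟩ (4 * (n : ℝ))
  have hsq : Integrable fun x => ‖v x‖ ^ 2 := by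
    have hc : Continuous fun x => ‖v x‖ ^ 2 := hv.continuous.norm.pow 2
    exact hc.integrable_of_hasCompactSupport
      (hvs.comp_left (g := fun z : ℂ => ‖z‖ ^ 2) (by simp))
  have hgrad : Integrable fun x => ‖fderiv ℝ v x‖ ^ 2 := by
    have hc : Continuous fun x => ‖fderiv ℝ v x‖ ^ 2 :=
      (hv.continuous_fderiv (by norm_num)).norm.pow 2
    exact hc.integrable_of_hasCompactSupport
      ((hvs.fderiv ℝ).comp_left (g := fun z : Ed d →L[ℝ] ℂ => ‖z‖ ^ 2) (by simp))
  refine ⟨fun n x => v (x - c n), fun n => ?_, fun n => ?_, fun n => ?_, fun j k => ?_⟩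
  · exact hv.comp (contDiff_id.sub contDiff_const)
  · exact hsq.comp_sub_right (c n)
  · simp only [fderiv_comp_sub]
    exact hgrad.comp_sub_right (c n)
  · rcases eq_or_ne j k with rfl | hjk
    · rw [integral_sub_right_eq_self (fun x => v x * (starRingEnd ℂ) (v x)) (c j), hv1, if_pos rfl]
    · rw [if_neg hjk]
      refine integral_eq_zero_of_ae (ae_of_all _ fun x => ?_)
      have hfar : 4 ≤ ‖c j - c k‖ := by
        have h1 : (1 : ℝ) ≤ |(j : ℝ) - k| := by
          have : (j : ℤ) - k ≠ 0 := by
            have := Fin.val_ne_of_ne hjk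
            lia
          exact_mod_cast Int.one_le_abs this
        have h2 : c j - c k = EuclideanSpace.single ⟨0, hd⟩ (4 * ((j : ℝ) - k)) := by
          ext i
          by_cases hi : i = ⟨0, hd⟩ <;> simp [c, hi, mul_sub]
        rw [h2, PiLp.norm_single, norm_mul, Real.norm_eq_abs, Real.norm_eq_abs,
          abs_of_pos four_pos]
        linarith
      rcases le_or_gt 2 ‖x - c j‖ with h | h
      · simp [hv0 _ h]
      · have h2 : 2 ≤ ‖x - c k‖ := by
          have := norm_sub_le (x - c k) (x - c j)
          rw [sub_sub_sub_cancel_left] at this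
          linarith
        simp [hv0 _ h2]

/-- linear lower bound and negativity: there is `C > 0` with
`-Cλ ≤ J(λ) < 0` for all `λ > 0`. -/
theorem statement7 (d : ℕ) (hd : 1 ≤ d) (p : ℝ) (hp1 : 1 < p)
    (hp2 : p < 1 + 2 / d) :
    ∃ C : ℝ, 0 < C ∧ ∀ lam : ℝ, 0 < lam →
      -C * lam ≤ Jw d p lam ∧ Jw d p lam < 0 := by
  have hp0 : 0 < p := by linarith
  have hd0 : (0 : ℝ) < d := by exact_mod_cast hd
  have hdp : d * (p - 1) < 2 := by
    have : p - 1 < 2 / d := by linarith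
    rwa [lt_div_iff₀' hd0] at this
  obtain ⟨C, hC, h⟩ := exists_integral_densityW_rpow_le hd hp1 hp2
  refine ⟨C, hC, fun lam hlam => ?_⟩
  obtain ⟨u, hu⟩ := exists_admissible hd ⌈lam⌉₊
  have hlow : ∀ e ∈ { e : ℝ | ∃ u : Fin ⌈lam⌉₊ → Ed d → ℂ,
      Admissible d ⌈lam⌉₊ u ∧ e = energyW d ⌈lam⌉₊ p lam u }, -C * lam ≤ e := by
    rintro _ ⟨v, hv, rfl⟩
    have hb := (h lam hlam v hv).2
    have hK := kineticW_nonneg (u := v) hlam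
    have hle : 1 / p * ∫ x, densityW d ⌈lam⌉₊ lam v x ^ p ≤
        C * lam + kineticW d ⌈lam⌉₊ lam v :=
      calc _ ≤ 1 / p * (C * lam + kineticW d ⌈lam⌉₊ lam v) := by gcongr
        _ ≤ _ := mul_le_of_le_one_left (by positivity) ((div_le_one hp0).2 hp1.le)
    rw [energyW]
    linarith
  obtain ⟨s, hs, hneg⟩ := hu.exists_energyW_dilate_neg hlam hp0 hdp (h lam hlam u hu).1
  exact ⟨le_csInf ⟨_, u, hu, rfl⟩ hlow,
    (csInf_le ⟨_, hlow⟩ ⟨_, hu.dilate hs, rfl⟩).trans_lt hneg⟩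
end
end
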